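/- arXiv:math/0411308 — 3 statements merged into one kernel-verified Lean document; each statement's English description precedes it below -/
import Mathlib

section
/- Let W ⊂ ℂⁿ be a uniformly flat smooth closed complex hypersurface with tubular neighborhood radius ε₀, let 0 < ε ≤ ε₀, let 1 ≤ p < ∞, and let φ be a C² plurisubharmonic function on ℂⁿ with i∂∂̄φ ≤ Mω. Then there is a constant C > 0, depending only on p, M and ε₀, such that for every holomorphic function F on the neighborhood N_ε(W) = {z : dist(z,W) < ε}, one has C ε² ∫_W |F|^p e^{-pφ} dσ ≤ ∫_{N_ε(W)} |F|^p e^{-pφ} dV. -/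
open MeasureTheory Metric Set
open scoped ENNReal NNReal Topology

noncomputable section

/-- `ℂⁿ` with the Euclidean (Hermitian) norm. -/
abbrev En (n : ℕ) : Type := EuclideanSpace ℂ (Fin n)

instance (n : ℕ) : MeasurableSpace (En n) := borel _
instance (n : ℕ) : BorelSpace (En n) := ⟨rfl⟩

/-- Lebesgue measure on `ℂⁿ ≅ ℝ^{2n}`, realized as `2n`-dimensional Hausdorff measure. -/
def vol (n : ℕ) : Measure (En n) := μH[(2 * n : ℝ)]

/-- The surface measure `dσ` on a hypersurface `W` induced by `ω^{n-1}`: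
a constant multiple of `(2n-2)`-dimensional Hausdorff measure restricted to `W`. -/
def surf (n : ℕ) (W : Set (En n)) : Measure (En n) :=
  ((2 : ℝ≥0∞) ^ (n - 1) * (Nat.factorial (n - 1) : ℝ≥0∞)) •
    (μH[(2 * n - 2 : ℝ)] : Measure (En n)).restrict W

open Classical in
/-- The weighted `L^p`-"norm" (to the `p`-th power for `p < ∞`) of `F` over the set `S`
with respect to the measure `μ` and the weight `φ`; for `p = ∞` it is the weighted sup. -/
def wNorm {n : ℕ} (p : ℝ≥0∞) (φ : En n → ℝ) (μ : Measure (En n)) (S : Set (En n))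
    (F : En n → ℂ) : ℝ≥0∞ :=
  if p = ⊤ then ⨆ z ∈ S, ENNReal.ofReal (‖F z‖ * Real.exp (-φ z))
  else ∫⁻ z in S, ENNReal.ofReal (‖F z‖ ^ p.toReal * Real.exp (-(p.toReal * φ z))) ∂μ

/-- Real Hessian of `φ` at `z` in the directions `u`, `v`. -/
def hess {n : ℕ} (φ : En n → ℝ) (z u v : En n) : ℝ := fderiv ℝ (fderiv ℝ φ) z u v

/-- The Levi form `i∂∂̄φ(z)(v,v̄) = Σ φ_{j k̄}(z) v_j v̄_k`, expressed through the
real Hessian.  For `φ = ‖z‖²` it equals `‖v‖²`, i.e. `ω = i∂∂̄‖z‖²` corresponds to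
`levi = ‖v‖²`. -/
def levi {n : ℕ} (φ : En n → ℝ) (z v : En n) : ℝ :=
  (hess φ z v v + hess φ z (Complex.I • v) (Complex.I • v)) / 4

/-- `W` is uniformly flat with tubular radius `ε₀`: the neighborhood
`N_{ε₀}(W)` is a tubular neighborhood, i.e. every point of it has a unique nearest
point on `W` and the (smooth) nearest-point projection `pr` is well defined there. -/
def UniformlyFlatWith {n : ℕ} (ε₀ : ℝ) (W : Set (En n)) : Prop :=
  0 < ε₀ ∧ ∃ pr : En n → En n,
    ContDiffOn ℝ (⊤ : ℕ∞) pr {z | Metric.infDist z W < ε₀} ∧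
    ∀ z : En n, Metric.infDist z W < ε₀ →
      pr z ∈ W ∧ dist z (pr z) = Metric.infDist z W ∧
        ∀ w ∈ W, dist z w = Metric.infDist z W → w = pr z

/-- `W` is uniformly flat. -/
def UniformlyFlat {n : ℕ} (W : Set (En n)) : Prop := ∃ ε₀, UniformlyFlatWith ε₀ W

/-- `f` is holomorphic on the complex submanifold `W`: near every point of `W` it is
the restriction of some holomorphic function of the ambient space. -/
def HolOn {n : ℕ} (W : Set (En n)) (f : En n → ℂ) : Prop :=
  ∀ w ∈ W, ∃ U ∈ 𝓝 w, ∃ g : En n → ℂ, DifferentiableOn ℂ g U ∧ Set.EqOn f g (U ∩ W)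

/-- The average `φ_r` of `φ` over the ball `B(z,r)`. -/
def avgBall {n : ℕ} (φ : En n → ℝ) (r : ℝ) (z : En n) : ℝ :=
  ((vol n) (Metric.ball z r)).toReal⁻¹ * ∫ x in Metric.ball z r, φ x ∂(vol n)

/-- The averaged current of integration `Υ_W(z,r)(v,v̄)`: by Lelong–Poincaré,
`Υ_W(z,r)(v,v) = (π / vol B(z,r)) ∫_{W ∩ B(z,r)} |⟨v, n_w⟩|² dσ(w)`, where the unit
normal pairing is `|⟨v, n_w⟩| = ‖dT_w(v)‖ / ‖dT_w‖` for a defining function `T` of `W`. -/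
def Upsilon {n : ℕ} (T : En n → ℂ) (W : Set (En n)) (r : ℝ) (z v : En n) : ℝ :=
  (Real.pi / ((vol n) (Metric.ball z r)).toReal) *
    ∫ w in Metric.ball z r, (‖fderiv ℂ T w v‖ / ‖fderiv ℂ T w‖) ^ 2 ∂(surf n W)

theorem hasDerivAt_intervalIntegral_of_continuous {f f' : ℝ → ℝ → ℝ}
    (hf : Continuous fun q : ℝ × ℝ => f q.1 q.2) (hf' : Continuous fun q : ℝ × ℝ => f' q.1 q.2)
    (h : ∀ r θ, HasDerivAt (fun s => f s θ) (f' r θ) r) (a b r : ℝ) :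
    HasDerivAt (fun s => ∫ θ in a..b, f s θ) (∫ θ in a..b, f' r θ) r := by
  have hK : IsCompact (closedBall r 1 ×ˢ uIcc a b) := (isCompact_closedBall r 1).prod isCompact_uIcc
  obtain ⟨C, hC⟩ := hK.exists_bound_of_continuousOn hf'.continuousOn
  refine (intervalIntegral.hasDerivAt_integral_of_dominated_loc_of_deriv_le
    (bound := fun _ => C) (closedBall_mem_nhds r one_pos) ?_ ?_ ?_ ?_ ?_ ?_).2
  · exact .of_forall fun s => (show Continuous (f s) by fun_prop).aestronglyMeasurable
  · exact (show Continuous (f r) by fun_prop).intervalIntegrable _ _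
  · exact (show Continuous (f' r) by fun_prop).aestronglyMeasurable
  · exact .of_forall fun t ht s hs => hC (s, t) ⟨hs, uIoc_subset_uIcc ht⟩
  · exact intervalIntegrable_const
  · exact .of_forall fun t _ s _ => h s t

theorem integral_circle_le_of_laplacian_le {E : Type*} [NormedAddCommGroup E] [NormedSpace ℝ E]
    {φ : E → ℝ} (hφ : ContDiff ℝ 2 φ) (w a b : E) {K : ℝ}
    (hK : ∀ (z : E) (θ : ℝ),
      fderiv ℝ (fderiv ℝ φ) z (Real.cos θ • a + Real.sin θ • b)
          (Real.cos θ • a + Real.sin θ • b)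
        + fderiv ℝ (fderiv ℝ φ) z (-Real.sin θ • a + Real.cos θ • b)
          (-Real.sin θ • a + Real.cos θ • b) ≤ 4 * K) :
    ∫ θ in (0)..(2 * Real.pi), φ (w + (Real.cos θ • a + Real.sin θ • b)) ≤
      2 * Real.pi * (φ w + K) := by
  set e : ℝ → E := fun θ => Real.cos θ • a + Real.sin θ • b with he
  set e' : ℝ → E := fun θ => -Real.sin θ • a + Real.cos θ • b with he'
  have hec : Continuous e := by fun_prop
  have hec' : Continuous e' := by fun_prop
  have hde : ∀ θ, HasDerivAt e (e' θ) θ := fun θ =>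
    ((Real.hasDerivAt_cos θ).smul_const a).add ((Real.hasDerivAt_sin θ).smul_const b)
  have hde' : ∀ θ, HasDerivAt e' (-e θ) θ := fun θ => by
    have := ((Real.hasDerivAt_sin θ).neg.smul_const a).add ((Real.hasDerivAt_cos θ).smul_const b)
    refine this.congr_deriv ?_
    simp only [he, neg_smul, neg_add]
  have h1 : ContDiff ℝ 1 (fderiv ℝ φ) := hφ.fderiv_right (by norm_num)
  have hφc : Continuous φ := hφ.continuous
  have hDc : Continuous (fderiv ℝ φ) := h1.continuous
  have hHc : Continuous (fderiv ℝ (fderiv ℝ φ)) := h1.continuous_fderiv (by norm_num)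
  have hDφ : ∀ z, HasFDerivAt φ (fderiv ℝ φ z) z := fun z =>
    (hφ.differentiable (by norm_num) z).hasFDerivAt
  have hDD : ∀ z, HasFDerivAt (fderiv ℝ φ) (fderiv ℝ (fderiv ℝ φ) z) z := fun z =>
    (h1.differentiable (by norm_num) z).hasFDerivAt
  have hline : ∀ r θ : ℝ, HasDerivAt (fun s : ℝ => w + s • e θ) (e θ) r := fun r θ => by
    simpa using ((hasDerivAt_id r).smul_const (e θ)).const_add w
  have hcirc : ∀ r θ : ℝ, HasDerivAt (fun t : ℝ => w + r • e t) (r • e' θ) θ := fun r θ =>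
    ((hde θ).const_smul r).const_add w
  set G : ℝ → ℝ → ℝ := fun r θ => fderiv ℝ φ (w + r • e θ) (e θ) with hG
  set H : ℝ → ℝ → ℝ := fun r θ => fderiv ℝ (fderiv ℝ φ) (w + r • e θ) (e θ) (e θ) with hH
  set H' : ℝ → ℝ → ℝ := fun r θ => fderiv ℝ (fderiv ℝ φ) (w + r • e θ) (e' θ) (e' θ) with hH'
  have hGc : Continuous fun q : ℝ × ℝ => G q.1 q.2 := by
    simp only [hG]; fun_prop
  have hHc1 : Continuous fun q : ℝ × ℝ => H q.1 q.2 := by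
    simp only [hH]; fun_prop
  have hHc2 : Continuous fun q : ℝ × ℝ => H' q.1 q.2 := by
    simp only [hH']; fun_prop
  have hP : ∀ r, HasDerivAt (fun s => ∫ θ in (0)..(2 * Real.pi), φ (w + s • e θ))
      (∫ θ in (0)..(2 * Real.pi), G r θ) r := fun r =>
    hasDerivAt_intervalIntegral_of_continuous (f := fun s θ => φ (w + s • e θ)) (by fun_prop) hGc
      (fun r θ => (hDφ _).comp_hasDerivAt r (hline r θ)) _ _ _
  have hN : ∀ r, HasDerivAt (fun s => ∫ θ in (0)..(2 * Real.pi), s * G s θ)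
      (∫ θ in (0)..(2 * Real.pi), (G r θ + r * H r θ)) r := fun r => by
    refine hasDerivAt_intervalIntegral_of_continuous (f := fun s θ => s * G s θ)
      (f' := fun s θ => G s θ + s * H s θ) (by fun_prop) (by fun_prop) (fun r θ => ?_) _ _ _
    have h2 : HasDerivAt (fun s => G s θ) (H r θ) r := by
      have := ((hDD _).comp_hasDerivAt r (hline r θ)).clm_apply (hasDerivAt_const r (e θ))
      simpa using this
    exact ((hasDerivAt_id' r).mul h2).congr_deriv (by simp)
  have hzero : ∀ r, ∫ θ in (0)..(2 * Real.pi), (r * H' r θ - G r θ) = 0 := fun r => by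
    have := intervalIntegral.integral_eq_sub_of_hasDerivAt (a := 0) (b := 2 * Real.pi)
      (f := fun θ => fderiv ℝ φ (w + r • e θ) (e' θ)) (f' := fun θ => r * H' r θ - G r θ)
      (fun θ _ => by
        have := ((hDD _).comp_hasDerivAt θ (hcirc r θ)).clm_apply (hde' θ)
        refine this.congr_deriv ?_
        simp [hG, hH', sub_eq_add_neg])
      ((show Continuous fun θ => r * H' r θ - G r θ by fun_prop).intervalIntegrable _ _)
    rw [this]
    simp [he, he']
  have hpi := Real.pi_pos
  have hN' : ∀ r, 0 ≤ r → ∫ θ in (0)..(2 * Real.pi), (G r θ + r * H r θ) ≤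
      2 * Real.pi * (4 * K * r) := fun r hr => by
    have : ∫ θ in (0)..(2 * Real.pi), (G r θ + r * H r θ) =
        ∫ θ in (0)..(2 * Real.pi), ((G r θ + r * H r θ) + (r * H' r θ - G r θ)) := by
      have hadd := intervalIntegral.integral_add (μ := volume)
        ((show Continuous fun θ => G r θ + r * H r θ by fun_prop).intervalIntegrable 0
          (2 * Real.pi))
        ((show Continuous fun θ => r * H' r θ - G r θ by fun_prop).intervalIntegrable 0
          (2 * Real.pi))
      rw [hzero, add_zero] at hadd
      exact hadd.symm
    rw [this]
    calc _ ≤ ∫ θ in (0)..(2 * Real.pi), 4 * K * r := by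
          refine intervalIntegral.integral_mono_on (by positivity) ?_ intervalIntegrable_const ?_
          · exact (show Continuous fun θ => (G r θ + r * H r θ) + (r * H' r θ - G r θ) by
              fun_prop).intervalIntegrable _ _
          · intro θ _
            have := mul_le_mul_of_nonneg_left (hK (w + r • e θ) θ) hr
            simp only [hH, hH', he, he'] at this ⊢
            linarith
      _ = _ := by simp; ring
  have hNle : ∀ r, 0 ≤ r → ∫ θ in (0)..(2 * Real.pi), r * G r θ ≤
      2 * Real.pi * (2 * K * r ^ 2) := fun r hr => by
    have := image_le_of_deriv_right_le_deriv_boundary (a := 0) (b := r)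
      (f := fun s => ∫ θ in (0)..(2 * Real.pi), s * G s θ)
      (B := fun s => 2 * Real.pi * (2 * K * s ^ 2)) (B' := fun s => 2 * Real.pi * (4 * K * s))
      (fun s _ => (hN s).continuousAt.continuousWithinAt) (fun s _ => (hN s).hasDerivWithinAt)
      (by simp) (by fun_prop)
      (fun s _ => by
        refine HasDerivAt.hasDerivWithinAt ?_
        refine (((hasDerivAt_pow 2 s).const_mul (2 * K)).const_mul (2 * Real.pi)).congr_deriv ?_
        simp; ring)
      (fun s hs => hN' s hs.1) (x := r) ⟨hr, le_rfl⟩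
    exact this
  have hPle : ∫ θ in (0)..(2 * Real.pi), φ (w + (1 : ℝ) • e θ) ≤
      2 * Real.pi * (φ w + K * 1 ^ 2) := by
    have := image_le_of_deriv_right_le_deriv_boundary (a := 0) (b := 1)
      (f := fun s => ∫ θ in (0)..(2 * Real.pi), φ (w + s • e θ))
      (B := fun s => 2 * Real.pi * (φ w + K * s ^ 2)) (B' := fun s => 2 * Real.pi * (2 * K * s))
      (fun s _ => (hP s).continuousAt.continuousWithinAt) (fun s _ => (hP s).hasDerivWithinAt)
      (by simp) (by fun_prop)
      (fun s _ => by
        refine HasDerivAt.hasDerivWithinAt ?_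
        refine ((((hasDerivAt_pow 2 s).const_mul K).const_add (φ w)).const_mul
          (2 * Real.pi)).congr_deriv ?_
        simp; ring)
      (fun s hs => ?_) (x := 1) ⟨zero_le_one, le_rfl⟩
    · exact this
    · rcases hs.1.eq_or_lt with h | h
      · subst h
        have := hN' 0 le_rfl
        simpa using this
      · have := hNle s h.le
        rw [intervalIntegral.integral_const_mul] at this
        refine le_of_mul_le_mul_left (this.trans_eq ?_) h
        ring
  simpa using hPle

theorem log_norm_le_circleAverage {f : ℂ → ℂ} (hf : AnalyticOnNhd ℂ f (closedBall 0 1))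
    (h0 : f 0 ≠ 0) :
    2 * Real.pi * Real.log ‖f 0‖ ≤
      ∫ θ in (0)..(2 * Real.pi), Real.log ‖f (circleMap 0 1 θ)‖ := by
  have hf' : AnalyticOnNhd ℂ f (closedBall 0 |1|) := by simpa using hf
  have hJ := hf'.circleAverage_log_norm one_ne_zero h0
  have hnn : 0 ≤ ∑ᶠ u, (MeromorphicOn.divisor f (closedBall 0 |1|) u : ℝ) *
      Real.log (1 * ‖(0 : ℂ) - u‖⁻¹) := by
    refine finsum_nonneg fun u => ?_
    by_cases hu : u ∈ closedBall (0 : ℂ) |1|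
    · refine mul_nonneg ?_ ?_
      · exact_mod_cast MeromorphicOn.AnalyticOnNhd.divisor_nonneg hf' u
      · have hu' : ‖u‖ ≤ 1 := by simpa using hu
        rw [one_mul, zero_sub, norm_neg, Real.log_inv]
        linarith [Real.log_nonpos (norm_nonneg u) hu']
    · rw [Function.locallyFinsuppWithin.apply_eq_zero_of_notMem _ hu]
      simp
  rw [Real.circleAverage_def, smul_eq_mul] at hJ
  have hpi := Real.pi_pos
  have : Real.log ‖f 0‖ ≤ (2 * Real.pi)⁻¹ *
      ∫ θ in (0)..(2 * Real.pi), Real.log ‖f (circleMap 0 1 θ)‖ := by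
    rw [hJ]; linarith
  rwa [le_inv_mul_iff₀ (by positivity)] at this

theorem norm_rpow_mul_exp_le_circle {f : ℂ → ℂ} (hf : AnalyticOnNhd ℂ f (closedBall 0 1))
    {p : ℝ} (hp : 0 < p) {φ : ℝ → ℝ} (hφ : Continuous φ) {A : ℝ}
    (hA : ∫ θ in (0)..(2 * Real.pi), φ θ ≤ 2 * Real.pi * A) :
    2 * Real.pi * (‖f 0‖ ^ p * Real.exp (-(p * A))) ≤
      ∫ θ in (0)..(2 * Real.pi), ‖f (circleMap 0 1 θ)‖ ^ p * Real.exp (-(p * φ θ)) := by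
  have hpi := Real.pi_pos
  by_cases h0 : f 0 = 0
  · rw [h0, norm_zero, Real.zero_rpow hp.ne']
    simp only [zero_mul, mul_zero]
    exact intervalIntegral.integral_nonneg (by positivity) fun θ _ => by positivity
  have hf' : AnalyticOnNhd ℂ f (closedBall 0 |1|) := by simpa using hf
  have hmem : ∀ θ, circleMap 0 1 θ ∈ closedBall (0 : ℂ) 1 := fun θ =>
    circleMap_mem_closedBall 0 zero_le_one θ
  have hfc : Continuous fun θ => f (circleMap 0 1 θ) :=
    hf.continuousOn.comp_continuous (continuous_circleMap 0 1) hmem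
  have hne : ∀ᵐ θ ∂(volume.restrict (uIoc 0 (2 * Real.pi))), f (circleMap 0 1 θ) ≠ 0 := by
    have h1 := hf'.preimage_zero_mem_codiscreteWithin h0 (by simp)
      ((convex_closedBall (0 : ℂ) |1|).isConnected ⟨0, by simp⟩)
    have h2 := circleMap_preimage_codiscrete (c := 0) (R := 1) one_ne_zero
      (Filter.codiscreteWithin_mono sphere_subset_closedBall h1)
    exact ae_restrict_le_codiscreteWithin measurableSet_uIoc
      (Filter.codiscreteWithin_mono (by tauto) h2)
  have hint : IntervalIntegrable (fun θ => Real.log ‖f (circleMap 0 1 θ)‖) volume 0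
      (2 * Real.pi) :=
    ((hf'.mono sphere_subset_closedBall).meromorphicOn).circleIntegrable_log_norm
  have hφi : IntervalIntegrable φ volume 0 (2 * Real.pi) := hφ.intervalIntegrable _ _
  set a : ℝ := p * Real.log ‖f 0‖ - p * A with ha
  have hea : ‖f 0‖ ^ p * Real.exp (-(p * A)) = Real.exp a := by
    rw [Real.rpow_def_of_pos (norm_pos_iff.2 h0), ← Real.exp_add, ha]
    ring_nf
  have key : ∫ θ in (0)..(2 * Real.pi), Real.exp a *
        ((1 - a) + (p * Real.log ‖f (circleMap 0 1 θ)‖ - p * φ θ)) ≤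
      ∫ θ in (0)..(2 * Real.pi), ‖f (circleMap 0 1 θ)‖ ^ p * Real.exp (-(p * φ θ)) := by
    refine intervalIntegral.integral_mono_ae_restrict (by positivity) ?_ ?_ ?_
    · exact (intervalIntegrable_const.add ((hint.const_mul p).sub (hφi.const_mul p))).const_mul _
    · refine Continuous.intervalIntegrable ?_ _ _
      exact (hfc.norm.rpow_const fun _ => Or.inr hp.le).mul (by fun_prop)
    · rw [uIoc_of_le (by positivity)] at hne
      rw [← Measure.restrict_congr_set Ioc_ae_eq_Icc]
      filter_upwards [hne] with θ hθ
      have h1 : ‖f (circleMap 0 1 θ)‖ ^ p * Real.exp (-(p * φ θ)) =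
          Real.exp a * Real.exp (p * Real.log ‖f (circleMap 0 1 θ)‖ - p * φ θ - a) := by
        rw [Real.rpow_def_of_pos (norm_pos_iff.2 hθ), ← Real.exp_add, ← Real.exp_add]
        ring_nf
      rw [h1]
      refine mul_le_mul_of_nonneg_left ?_ (Real.exp_pos a).le
      have := Real.add_one_le_exp (p * Real.log ‖f (circleMap 0 1 θ)‖ - p * φ θ - a)
      linarith
  refine le_trans ?_ key
  rw [hea, intervalIntegral.integral_const_mul, intervalIntegral.integral_add
    intervalIntegrable_const ((hint.const_mul p).sub (hφi.const_mul p)),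
    intervalIntegral.integral_sub (hint.const_mul p) (hφi.const_mul p),
    intervalIntegral.integral_const_mul, intervalIntegral.integral_const_mul,
    intervalIntegral.integral_const, mul_comm]
  refine mul_le_mul_of_nonneg_left ?_ (Real.exp_pos a).le
  have h1 := mul_le_mul_of_nonneg_left (log_norm_le_circleAverage hf h0) hp.le
  have h2 := mul_le_mul_of_nonneg_left hA hp.le
  simp only [sub_zero, smul_eq_mul]
  have : 2 * Real.pi * a = p * (2 * Real.pi * Real.log ‖f 0‖) - p * (2 * Real.pi * A) := by
    rw [ha]; ring
  linarith

theorem weighted_rpow_le_circle {n : ℕ} {p M : ℝ} (hp : 0 < p) {φ : En n → ℝ}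
    (hφ : ContDiff ℝ 2 φ) (hM : ∀ z v : En n, levi φ z v ≤ M * ‖v‖ ^ 2) {F : En n → ℂ}
    {U : Set (En n)} (hU : IsOpen U) (hF : DifferentiableOn ℂ F U) {w v : En n}
    (hv : closedBall w ‖v‖ ⊆ U) :
    2 * Real.pi * (‖F w‖ ^ p * Real.exp (-(p * φ w))) ≤
      Real.exp (p * M * ‖v‖ ^ 2) * ∫ θ in (0)..(2 * Real.pi),
        ‖F (w + circleMap 0 1 θ • v)‖ ^ p * Real.exp (-(p * φ (w + circleMap 0 1 θ • v))) := by
  have hcirc : ∀ θ : ℝ, Real.cos θ • v + Real.sin θ • (Complex.I • v) = circleMap 0 1 θ • v := by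
    intro θ
    rw [circleMap, ← Complex.coe_smul (Real.cos θ), ← Complex.coe_smul (Real.sin θ), smul_smul,
      ← add_smul, Complex.exp_mul_I]
    simp
  have hcirc' : ∀ θ : ℝ, -Real.sin θ • v + Real.cos θ • (Complex.I • v) =
      Complex.I • circleMap 0 1 θ • v := by
    intro θ
    rw [← hcirc, smul_add, smul_comm Complex.I (Real.cos θ), smul_comm Complex.I (Real.sin θ),
      smul_smul Complex.I, Complex.I_mul_I, neg_one_smul, smul_neg, neg_smul, add_comm]
  have hnorm : ∀ θ : ℝ, ‖circleMap 0 1 θ • v‖ = ‖v‖ := fun θ => by simp [norm_smul]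
  have hA := integral_circle_le_of_laplacian_le hφ w v (Complex.I • v) (K := M * ‖v‖ ^ 2)
    (fun z θ => by
      have := hM z (circleMap 0 1 θ • v)
      rw [hnorm] at this
      simp only [levi, hess] at this
      rw [hcirc, hcirc']
      linarith)
  simp only [hcirc] at hA
  have hφc := hφ.continuous
  have han : AnalyticOnNhd ℂ (fun ζ : ℂ => F (w + ζ • v)) (closedBall 0 1) := by
    have hopen : IsOpen ((fun ζ : ℂ => w + ζ • v) ⁻¹' U) := hU.preimage (by fun_prop)
    have hd : DifferentiableOn ℂ (fun ζ : ℂ => F (w + ζ • v)) ((fun ζ : ℂ => w + ζ • v) ⁻¹' U) :=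
      hF.comp (by fun_prop) (fun _ h => h)
    refine (hd.analyticOnNhd hopen).mono fun ζ hζ => hv ?_
    have hζ' : ‖ζ‖ ≤ 1 := by simpa using hζ
    simpa [norm_smul] using mul_le_mul_of_nonneg_right hζ' (norm_nonneg v)
  have key := norm_rpow_mul_exp_le_circle han hp
    (φ := fun θ => φ (w + circleMap 0 1 θ • v)) (by fun_prop) hA
  simp only [zero_smul, add_zero] at key
  have hE : Real.exp (-(p * φ w)) =
      Real.exp (p * M * ‖v‖ ^ 2) * Real.exp (-(p * (φ w + M * ‖v‖ ^ 2))) := by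
    rw [← Real.exp_add]; ring_nf
  rw [hE]
  calc _ = Real.exp (p * M * ‖v‖ ^ 2) *
        (2 * Real.pi * (‖F w‖ ^ p * Real.exp (-(p * (φ w + M * ‖v‖ ^ 2))))) := by ring
    _ ≤ _ := mul_le_mul_of_nonneg_left key (Real.exp_pos _).le

instance isAddHaarMeasure_vol (n : ℕ) : (vol n).IsAddHaarMeasure := by
  have h : (2 * n : ℝ) = (Module.finrank ℝ (En n) : ℝ) := by
    rw [finrank_real_of_complex]; simp
  rw [vol, h]
  infer_instance

theorem measurePreserving_add_smul {n : ℕ} (w : En n) {c : ℂ} (hc : ‖c‖ = 1) :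
    MeasurePreserving (fun v : En n => w + c • v) (vol n) (vol n) := by
  have hc0 : c ≠ 0 := by rintro rfl; simp at hc
  exact (IsometryEquiv.mk' (fun v : En n => w + c • v) (fun v => c⁻¹ • (v - w))
    (fun v => by simp [smul_smul, hc0])
    (Isometry.of_dist_eq fun x y => by
      simp [dist_eq_norm, ← smul_sub, norm_smul, hc])).measurePreserving_hausdorffMeasure _

theorem weighted_rpow_mul_vol_ball_le {n : ℕ} {p M : ℝ} (hp : 0 < p) (hM0 : 0 ≤ M)
    {φ : En n → ℝ} (hφ : ContDiff ℝ 2 φ) (hM : ∀ z v : En n, levi φ z v ≤ M * ‖v‖ ^ 2)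
    {F : En n → ℂ} {w : En n} {r : ℝ} (hF : DifferentiableOn ℂ F (ball w r)) :
    ENNReal.ofReal (‖F w‖ ^ p * Real.exp (-(p * φ w))) * vol n (ball 0 r) ≤
      ENNReal.ofReal (Real.exp (p * M * r ^ 2)) *
        ∫⁻ z in ball w r, ENNReal.ofReal (‖F z‖ ^ p * Real.exp (-(p * φ z))) ∂(vol n) := by
  set g : En n → ℝ := fun z => ‖F z‖ ^ p * Real.exp (-(p * φ z)) with hg
  have hg0 : ∀ z, 0 ≤ g z := fun z => by positivity
  have hφc := hφ.continuous
  have hgc : ContinuousOn g (ball w r) := by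
    refine (hF.continuousOn.norm.rpow_const fun _ _ => Or.inr hp.le).mul ?_
    exact (show Continuous fun z => Real.exp (-(p * φ z)) by fun_prop).continuousOn
  set H : En n → ℝ≥0∞ := (ball w r).indicator fun z => ENNReal.ofReal (g z) with hH
  have hHm : Measurable H := by
    classical
    have : H = (ball w r).piecewise (fun z => ENNReal.ofReal (g z)) 0 := by
      rw [hH, ← Set.piecewise_eq_indicator]
    rw [this]
    exact (ENNReal.continuous_ofReal.comp_continuousOn hgc).measurable_piecewise
      continuousOn_const isOpen_ball.measurableSet
  have hpi := Real.pi_pos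
  set E := ENNReal.ofReal (Real.exp (p * M * r ^ 2)) with hE
  set τ := ENNReal.ofReal (2 * Real.pi) with hτ
  have hτ0 : τ ≠ 0 := by simp [hτ, hpi]
  have hτt : τ ≠ ⊤ := ENNReal.ofReal_ne_top
  have hmap : Continuous fun q : En n × ℝ => w + circleMap 0 1 q.2 • q.1 := by fun_prop
  have hcircle : ∀ v ∈ ball (0 : En n) r, τ * ENNReal.ofReal (g w) ≤
      E * ∫⁻ θ in Ioc 0 (2 * Real.pi), H (w + circleMap 0 1 θ • v) := by
    intro v hv
    have hv' : ‖v‖ < r := by simpa using hv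
    have hmem : ∀ θ : ℝ, w + circleMap 0 1 θ • v ∈ ball w r := fun θ => by
      simpa [norm_smul] using hv'
    have hcirc := weighted_rpow_le_circle hp hφ hM isOpen_ball hF (w := w) (v := v)
      (closedBall_subset_ball hv')
    have hgcirc : Continuous fun θ : ℝ => g (w + circleMap 0 1 θ • v) :=
      hgc.comp_continuous (by fun_prop) hmem
    have hint : ENNReal.ofReal (∫ θ in (0)..(2 * Real.pi), g (w + circleMap 0 1 θ • v)) =
        ∫⁻ θ in Ioc 0 (2 * Real.pi), H (w + circleMap 0 1 θ • v) := by
      rw [intervalIntegral.integral_of_le (by positivity),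
        ofReal_integral_eq_lintegral_ofReal
          ((hgcirc.intervalIntegrable 0 (2 * Real.pi)).1) (.of_forall fun θ => hg0 _)]
      simp only [hH, indicator_of_mem (hmem _)]
    rw [← hint, hτ, hE, ← ENNReal.ofReal_mul (by positivity),
      ← ENNReal.ofReal_mul (Real.exp_pos _).le]
    refine ENNReal.ofReal_le_ofReal (hcirc.trans ?_)
    refine mul_le_mul_of_nonneg_right ?_
      (intervalIntegral.integral_nonneg (by positivity) fun θ _ => hg0 _)
    gcongr
  have hmain : τ * (ENNReal.ofReal (g w) * vol n (ball 0 r)) ≤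
      τ * (E * ∫⁻ z in ball w r, ENNReal.ofReal (g z) ∂(vol n)) := by
    calc τ * (ENNReal.ofReal (g w) * vol n (ball 0 r))
        = ∫⁻ _ in ball (0 : En n) r, τ * ENNReal.ofReal (g w) ∂(vol n) := by
          rw [setLIntegral_const, mul_assoc]
      _ ≤ ∫⁻ v in ball (0 : En n) r,
            E * (∫⁻ θ in Ioc 0 (2 * Real.pi), H (w + circleMap 0 1 θ • v)) ∂(vol n) :=
          setLIntegral_mono' isOpen_ball.measurableSet hcircle
      _ ≤ ∫⁻ v, E * (∫⁻ θ in Ioc 0 (2 * Real.pi), H (w + circleMap 0 1 θ • v)) ∂(vol n) :=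
          setLIntegral_le_lintegral _ _
      _ = E * ∫⁻ v, (∫⁻ θ in Ioc 0 (2 * Real.pi), H (w + circleMap 0 1 θ • v)) ∂(vol n) :=
          lintegral_const_mul' _ _ (by simp [hE])
      _ = E * ∫⁻ θ in Ioc 0 (2 * Real.pi), ∫⁻ v, H (w + circleMap 0 1 θ • v) ∂(vol n) := by
          rw [lintegral_lintegral_swap (f := fun v θ => H (w + circleMap 0 1 θ • v))
            (hHm.comp hmap.measurable).aemeasurable]
      _ = E * ∫⁻ _ in Ioc 0 (2 * Real.pi), ∫⁻ z, H z ∂(vol n) := by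
          congr 1
          refine lintegral_congr fun θ => ?_
          exact (measurePreserving_add_smul w (by simp)).lintegral_comp hHm
      _ = τ * (E * ∫⁻ z in ball w r, ENNReal.ofReal (g z) ∂(vol n)) := by
          rw [setLIntegral_const, Real.volume_Ioc, sub_zero, hH,
            lintegral_indicator isOpen_ball.measurableSet]
          ring
  exact (ENNReal.mul_le_mul_iff_right hτ0 hτt).1 hmain

theorem isOpen_infDist_lt {E : Type*} [PseudoMetricSpace E] (ε₀ : ℝ) (W : Set E) : IsOpen {z | infDist z W < ε₀} :=
  isOpen_lt (continuous_infDist_pt W) continuous_const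

theorem infDist_add_lt {E : Type*} [SeminormedAddCommGroup E] {ε₀ : ℝ} {W : Set E} {x d : E}
    (hx : x ∈ W) (hd : ‖d‖ < ε₀) : infDist (x + d) W < ε₀ :=
  (infDist_le_dist_of_mem hx).trans_lt (by simpa using hd)

section Reach

variable {E : Type*} [NormedAddCommGroup E] [InnerProductSpace ℝ E]

/-- `pr` is a smooth nearest-point projection of the `ε₀`-neighborhood of `W` onto `W`. -/
structure IsNearestProj (ε₀ : ℝ) (W : Set E) (pr : E → E) : Prop where
  contDiffOn : ContDiffOn ℝ (⊤ : ℕ∞) pr {z | infDist z W < ε₀}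
  mem : ∀ z, infDist z W < ε₀ → pr z ∈ W
  dist_eq : ∀ z, infDist z W < ε₀ → dist z (pr z) = infDist z W
  unique : ∀ z, infDist z W < ε₀ → ∀ w ∈ W, dist z w = infDist z W → w = pr z

namespace IsNearestProj

open scoped RealInnerProductSpace

variable {ε₀ : ℝ} {W : Set E} {pr : E → E}

theorem apply_eq (h : IsNearestProj ε₀ W pr) (hε : 0 < ε₀) {x : E} (hx : x ∈ W) : pr x = x := by
  have h0 : infDist x W = 0 := infDist_zero_of_mem hx
  exact (h.unique x (by rwa [h0]) x hx (by rw [h0, dist_self])).symm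

theorem differentiableAt (h : IsNearestProj ε₀ W pr) {z : E} (hz : infDist z W < ε₀) :
    DifferentiableAt ℝ pr z :=
  (h.contDiffOn.contDiffAt ((isOpen_infDist_lt ε₀ W).mem_nhds hz)).differentiableAt (by simp)

theorem norm_sub_le (h : IsNearestProj ε₀ W pr) {z y : E} (hz : infDist z W < ε₀) (hy : y ∈ W) :
    ‖z - pr z‖ ≤ ‖z - y‖ := by
  rw [← dist_eq_norm, h.dist_eq z hz, ← dist_eq_norm]
  exact infDist_le_dist_of_mem hy

theorem hasFDerivAt_norm_sq (h : IsNearestProj ε₀ W pr) {z : E} (hz : infDist z W < ε₀) :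
    HasFDerivAt (fun y => ‖y - pr y‖ ^ 2) (2 • innerSL ℝ (z - pr z)) z := by
  have h1 : HasFDerivAt (fun y => ‖y - pr z‖ ^ 2) (2 • innerSL ℝ (z - pr z)) z := by
    simpa using ((hasFDerivAt_id z).sub_const (pr z)).norm_sq
  have h2 : DifferentiableAt ℝ (fun y => ‖y - pr y‖ ^ 2) z :=
    (differentiableAt_id.sub (h.differentiableAt hz)).norm_sq ℝ
  have h3 : IsLocalMin (fun y => ‖y - pr z‖ ^ 2 - ‖y - pr y‖ ^ 2) z := by
    filter_upwards [(isOpen_infDist_lt ε₀ W).mem_nhds hz] with y hy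
    have := h.norm_sub_le hy (h.mem z hz)
    have : ‖y - pr y‖ ^ 2 ≤ ‖y - pr z‖ ^ 2 := by gcongr
    simpa using this
  have h4 := h3.hasFDerivAt_eq_zero (h1.sub h2.hasFDerivAt)
  rw [sub_eq_zero.1 h4]
  exact h2.hasFDerivAt

theorem inner_fderiv_comm (h : IsNearestProj ε₀ W pr) {z : E} (hz : infDist z W < ε₀) (u v : E) :
    ⟪fderiv ℝ pr z u, v⟫ = ⟪u, fderiv ℝ pr z v⟫ := by
  have h1 : ∀ᶠ y in 𝓝 z, HasFDerivAt (fun y => ‖y - pr y‖ ^ 2) (2 • innerSL ℝ (y - pr y)) y := by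
    filter_upwards [(isOpen_infDist_lt ε₀ W).mem_nhds hz] with y hy using h.hasFDerivAt_norm_sq hy
  have h2 : HasFDerivAt (fun y => 2 • innerSL ℝ (y - pr y))
      (2 • (innerSL ℝ).comp (ContinuousLinearMap.id ℝ E - fderiv ℝ pr z)) z :=
    (((innerSL ℝ).hasFDerivAt.comp z
      ((hasFDerivAt_id z).sub (h.differentiableAt hz).hasFDerivAt))).const_smul 2
  have h3 : 2 • ⟪u - fderiv ℝ pr z u, v⟫ = 2 • ⟪v - fderiv ℝ pr z v, u⟫ :=
    second_derivative_symmetric_of_eventually h1 h2 u v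
  rw [inner_sub_left, inner_sub_left, real_inner_comm u v,
    real_inner_comm u (fderiv ℝ pr z v)] at h3
  simp only [nsmul_eq_mul, Nat.cast_ofNat] at h3
  linarith

theorem fderiv_sub_eq_zero (h : IsNearestProj ε₀ W pr) {z : E} (hz : infDist z W < ε₀) :
    fderiv ℝ pr z (z - pr z) = 0 := by
  have h1 := ((hasFDerivAt_id z).sub (h.differentiableAt hz).hasFDerivAt).norm_sq
  have h2 : ∀ u, 2 • ⟪z - pr z, u - fderiv ℝ pr z u⟫ = 2 • ⟪z - pr z, u⟫ := fun u =>
    congrArg (fun L => L u) (h1.unique (h.hasFDerivAt_norm_sq hz))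
  have h3 := h2 (fderiv ℝ pr z (z - pr z))
  rw [inner_sub_right, ← h.inner_fderiv_comm hz (z - pr z) (fderiv ℝ pr z (z - pr z))] at h3
  rw [← inner_self_eq_zero (𝕜 := ℝ)]
  simp only [nsmul_eq_mul, Nat.cast_ofNat] at h3
  linarith

theorem apply_ray (h : IsNearestProj ε₀ W pr) {z : E} (hz : infDist z W < ε₀) {t : ℝ}
    (ht : 1 ≤ t) (htz : t * ‖z - pr z‖ < ε₀) : pr (pr z + t • (z - pr z)) = pr z := by
  set x := pr z with hx
  set d := z - x with hd
  have hmem : ∀ s ∈ Icc 1 t, infDist (x + s • d) W < ε₀ := by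
    intro s hs
    refine infDist_add_lt (h.mem z hz) ?_
    rw [norm_smul, Real.norm_of_nonneg (by linarith [hs.1])]
    exact (mul_le_mul_of_nonneg_right hs.2 (norm_nonneg d)).trans_lt htz
  have hγ : ∀ s : ℝ, HasDerivAt (fun s : ℝ => x + s • d) d s := fun s => by
    simpa using ((hasDerivAt_id s).smul_const d).const_add x
  have hder : ∀ s ∈ Icc 1 t, HasDerivAt (fun s : ℝ => pr (x + s • d) - x)
      (fderiv ℝ pr (x + s • d) d) s := fun s hs =>
    ((h.differentiableAt (hmem s hs)).hasFDerivAt.comp_hasDerivAt s (hγ s)).sub_const x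
  have hcont : ContinuousOn (fun s : ℝ => ‖fderiv ℝ pr (x + s • d)‖) (Icc 1 t) :=
    ((h.contDiffOn.continuousOn_fderiv_of_isOpen (isOpen_infDist_lt ε₀ W) (by simp)).comp
      (by fun_prop) hmem).norm
  obtain ⟨K, hK⟩ := isCompact_Icc.bddAbove_image hcont
  have hzero := eq_zero_of_abs_deriv_le_mul_abs_self_of_eq_zero_right
    (f := fun s : ℝ => pr (x + s • d) - x) (f' := fun s => fderiv ℝ pr (x + s • d) d) (K := K)
    (a := 1) (b := t)
    (fun s hs => (hder s hs).continuousAt.continuousWithinAt)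
    (fun s hs => (hder s (Ico_subset_Icc_self hs)).hasDerivWithinAt)
    (by simp [hd, ← hx])
    (fun s hs => by
      have hs' := Ico_subset_Icc_self hs
      have hs0 : 0 < s := by linarith [hs.1]
      have h1 := h.fderiv_sub_eq_zero (hmem s hs')
      have h2 : fderiv ℝ pr (x + s • d) (pr (x + s • d) - x) =
          s • fderiv ℝ pr (x + s • d) d := by
        rw [← map_smul, ← sub_eq_zero, ← map_sub, ← neg_eq_zero, ← map_neg, ← h1]
        congr 1
        abel
      calc ‖fderiv ℝ pr (x + s • d) d‖ ≤ s * ‖fderiv ℝ pr (x + s • d) d‖ :=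
            le_mul_of_one_le_left (norm_nonneg _) hs.1
        _ = ‖fderiv ℝ pr (x + s • d) (pr (x + s • d) - x)‖ := by
            rw [h2, norm_smul, Real.norm_of_nonneg hs0.le]
        _ ≤ ‖fderiv ℝ pr (x + s • d)‖ * ‖pr (x + s • d) - x‖ :=
            ContinuousLinearMap.le_opNorm _ _
        _ ≤ K * ‖pr (x + s • d) - x‖ :=
            mul_le_mul_of_nonneg_right (hK ⟨s, hs', rfl⟩) (norm_nonneg _))
  exact sub_eq_zero.1 (hzero t (right_mem_Icc.2 ht))

theorem le_norm_sub (h : IsNearestProj ε₀ W pr) {x y u : E} (hx : x ∈ W) (hy : y ∈ W)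
    (hu : ‖u‖ = 1) (hAu : fderiv ℝ pr x u = 0) {s : ℝ} (hs : 0 < s) (hsε : s < ε₀) :
    s ≤ ‖x + s • u - y‖ := by
  have hε : 0 < ε₀ := hs.trans hsε
  have hprx := h.apply_eq hε hx
  have hγ : HasDerivAt (fun t : ℝ => x + t • u) u 0 := by
    simpa using ((hasDerivAt_id (0 : ℝ)).smul_const u).const_add x
  have hder : HasDerivAt (fun t : ℝ => pr (x + t • u)) 0 0 := by
    have h1 : HasFDerivAt pr (fderiv ℝ pr x) (x + (0 : ℝ) • u) := by
      simpa using (h.differentiableAt (z := x) (by rwa [infDist_zero_of_mem hx])).hasFDerivAt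
    simpa [hAu, Function.comp_def] using h1.comp_hasDerivAt 0 hγ
  have hslope : Filter.Tendsto (fun t : ℝ => t⁻¹ • (pr (x + t • u) - x)) (𝓝[>] 0) (𝓝 0) := by
    have := (hasDerivAt_iff_tendsto_slope.1 hder).mono_left (nhdsGT_le_nhdsNE 0)
    refine this.congr fun t => ?_
    simp [slope_def_module, hprx]
  have hpr : Filter.Tendsto (fun t : ℝ => pr (x + t • u)) (𝓝[>] 0) (𝓝 x) := by
    have := hder.continuousAt.tendsto.mono_left (nhdsWithin_le_nhds (s := Ioi (0 : ℝ)))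
    simpa [hprx] using this
  have hL : Filter.Tendsto (fun t : ℝ => ‖s • u - s • t⁻¹ • (pr (x + t • u) - x)‖)
      (𝓝[>] 0) (𝓝 s) := by
    have := (tendsto_const_nhds (x := s • u)).sub (hslope.const_smul s)
    simpa [norm_smul, hu, abs_of_pos hs] using this.norm
  have hR : Filter.Tendsto (fun t : ℝ =>
      ‖pr (x + t • u) + (s • u - s • t⁻¹ • (pr (x + t • u) - x)) - y‖)
      (𝓝[>] 0) (𝓝 ‖x + s • u - y‖) := by
    have := (hpr.add ((tendsto_const_nhds (x := s • u)).sub (hslope.const_smul s))).sub_const y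
    simpa using this.norm
  refine le_of_tendsto_of_tendsto hL hR ?_
  have hev : ∀ᶠ t in 𝓝[>] (0 : ℝ), t ∈ Ioo 0 s := Ioo_mem_nhdsGT hs
  filter_upwards [hev] with t ht
  have ht0 : t ≠ 0 := ht.1.ne'
  have hz : infDist (x + t • u) W < ε₀ :=
    infDist_add_lt hx (by rw [norm_smul, hu, Real.norm_of_nonneg ht.1.le]; linarith [ht.2])
  have hzle : ‖x + t • u - pr (x + t • u)‖ ≤ t := by
    simpa [norm_smul, hu, abs_of_pos ht.1] using h.norm_sub_le hz hx
  have hst : s / t * ‖x + t • u - pr (x + t • u)‖ ≤ s := by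
    calc _ ≤ s / t * t := mul_le_mul_of_nonneg_left hzle (div_pos hs ht.1).le
      _ = s := div_mul_cancel₀ s ht0
  have hray := h.apply_ray hz ((one_le_div ht.1).2 ht.2.le) (hst.trans_lt hsε)
  have heq : s • u - s • t⁻¹ • (pr (x + t • u) - x) =
      (s / t) • (x + t • u - pr (x + t • u)) := by
    have : s • u = (s / t) • t • u := by rw [smul_smul, div_mul_cancel₀ s ht0]
    rw [this, smul_smul s, ← div_eq_mul_inv, ← smul_sub]
    congr 1
    abel
  rw [heq]
  have hq : infDist (pr (x + t • u) + (s / t) • (x + t • u - pr (x + t • u))) W < ε₀ := by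
    refine infDist_add_lt (h.mem _ hz) ?_
    rw [norm_smul, Real.norm_of_nonneg (div_pos hs ht.1).le]
    exact hst.trans_lt hsε
  have := h.norm_sub_le hq hy
  rwa [hray, add_sub_cancel_left] at this

theorem inner_sub_le (h : IsNearestProj ε₀ W pr) (hε : 0 < ε₀) {x y u : E} (hx : x ∈ W)
    (hy : y ∈ W) (hu : ‖u‖ = 1) (hAu : fderiv ℝ pr x u = 0) :
    ⟪u, y - x⟫ ≤ ‖y - x‖ ^ 2 / ε₀ := by
  have h1 := h.le_norm_sub hx hy hu hAu (half_pos hε) (half_lt_self hε)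
  have h2 : (ε₀ / 2) ^ 2 ≤ ‖x + (ε₀ / 2) • u - y‖ ^ 2 := by gcongr
  rw [show x + (ε₀ / 2) • u - y = (ε₀ / 2) • u - (y - x) by abel, norm_sub_sq_real, norm_smul,
    inner_smul_left, hu, mul_one, Real.norm_of_nonneg (half_pos hε).le] at h2
  rw [le_div_iff₀ hε]
  simp at h2
  linarith

theorem fderiv_eq_zero_of_forall_inner {F : Type*} [NormedAddCommGroup F] [NormedSpace ℝ F]
    (h : IsNearestProj ε₀ W pr) (hε : 0 < ε₀) {x u : E} (hx : x ∈ W) {T : E → F} {T' : E →L[ℝ] F}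
    (hT : HasFDerivAt T T' x) (hTW : ∀ y ∈ W, T y = 0) (hu : ∀ v, T' v = 0 → ⟪u, v⟫ = 0) :
    fderiv ℝ pr x u = 0 := by
  have hxN : infDist x W < ε₀ := by rwa [infDist_zero_of_mem hx]
  have hprx := h.apply_eq hε hx
  have hc : HasFDerivAt (fun y => T (pr y)) (T'.comp (fderiv ℝ pr x)) x := by
    refine HasFDerivAt.comp x ?_ (h.differentiableAt hxN).hasFDerivAt
    rwa [hprx]
  have h0 : HasFDerivAt (fun y => T (pr y)) (0 : E →L[ℝ] F) x := by
    refine (hasFDerivAt_const (0 : F) x).congr_of_eventuallyEq ?_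
    filter_upwards [(isOpen_infDist_lt ε₀ W).mem_nhds hxN] with y hy using hTW _ (h.mem y hy)
  have hker : ∀ v, T' (fderiv ℝ pr x v) = 0 := fun v =>
    congrArg (fun L : E →L[ℝ] F => L v) (hc.unique h0)
  rw [← inner_self_eq_zero (𝕜 := ℝ), h.inner_fderiv_comm hxN]
  exact hu _ (hker _)

end IsNearestProj

end Reach

section Area

open scoped InnerProductSpace

theorem real_inner_eq_re_complex {n : ℕ} (u v : En n) : inner ℝ u v = (inner ℂ u v).re := by
  simp [PiLp.inner_apply, Complex.inner]

theorem UniformlyFlatWith.exists_isNearestProj {n : ℕ} {ε₀ : ℝ} {W : Set (En n)}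
    (h : UniformlyFlatWith ε₀ W) : ∃ pr, IsNearestProj ε₀ W pr := by
  obtain ⟨-, pr, h1, h2⟩ := h
  exact ⟨pr, h1, fun z hz => (h2 z hz).1, fun z hz => (h2 z hz).2.1, fun z hz => (h2 z hz).2.2⟩

theorem exists_unit_normal {n : ℕ} {ε₀ : ℝ} {W : Set (En n)} (h : UniformlyFlatWith ε₀ W)
    {T : En n → ℂ} {x : En n} (hx : x ∈ W) (hT : DifferentiableAt ℂ T x) (hTW : ∀ y ∈ W, T y = 0)
    (hT0 : fderiv ℂ T x ≠ 0) :
    ∃ ν : En n, ‖ν‖ = 1 ∧ ∀ y ∈ W, ‖⟪ν, y - x⟫_ℂ‖ ≤ ‖y - x‖ ^ 2 / ε₀ := by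
  obtain ⟨pr, hpr⟩ := h.exists_isNearestProj
  set L := fderiv ℂ T x with hL
  set ν₀ := (InnerProductSpace.toDual ℂ (En n)).symm L with hν₀
  have hν₀L : ∀ v, ⟪ν₀, v⟫_ℂ = L v := fun v => InnerProductSpace.toDual_symm_apply
  have hν₀0 : ν₀ ≠ 0 := by simpa [hν₀] using hT0
  have hν₀n : (‖ν₀‖ : ℂ) ≠ 0 := by simpa using hν₀0
  refine ⟨(‖ν₀‖⁻¹ : ℂ) • ν₀, by simp [norm_smul, hν₀0], fun y hy => ?_⟩
  set a := ⟪(‖ν₀‖⁻¹ : ℂ) • ν₀, y - x⟫_ℂ with ha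
  by_cases ha0 : a = 0
  · rw [ha0, norm_zero]
    exact div_nonneg (sq_nonneg _) h.1.le
  have ha0' : (‖a‖ : ℂ) ≠ 0 := by simpa using ha0
  set u := (a / ‖a‖) • (‖ν₀‖⁻¹ : ℂ) • ν₀ with hu
  have hu1 : ‖u‖ = 1 := by simp [hu, norm_smul, hν₀0, ha0]
  have huy : ⟪u, y - x⟫_ℝ = ‖a‖ := by
    rw [real_inner_eq_re_complex, hu, inner_smul_left, ← ha, map_div₀, Complex.conj_ofReal,
      div_mul_eq_mul_div, Complex.conj_mul', pow_two, mul_div_assoc, div_self ha0', mul_one,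
      Complex.ofReal_re]
  rw [← huy]
  refine hpr.inner_sub_le h.1 hx hy hu1 ?_
  refine hpr.fderiv_eq_zero_of_forall_inner h.1 hx
    (hT.hasFDerivAt.restrictScalars ℝ) hTW fun v hv => ?_
  have hv' : L v = 0 := hv
  rw [real_inner_eq_re_complex, hu, inner_smul_left, inner_smul_left, hν₀L, hv']
  simp

theorem hausdorffMeasure_le_of_norm_inner_le {n : ℕ} {d : ℝ} (hd : 0 ≤ d) {ν : En n}
    (hν : ‖ν‖ = 1) {A : Set (En n)}
    (hA : ∀ x ∈ A, ∀ y ∈ A, ‖⟪ν, y - x⟫_ℂ‖ ≤ 1 / 2 * ‖y - x‖) :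
    μH[d] A ≤ (2 : ℝ≥0∞) ^ d * μH[d] ((ℂ ∙ ν)ᗮ.orthogonalProjectionOnto '' A) := by
  set P := (ℂ ∙ ν)ᗮ.orthogonalProjectionOnto with hP
  have hnorm : ∀ v : En n, ‖v‖ ^ 2 = ‖⟪ν, v⟫_ℂ‖ ^ 2 + ‖P v‖ ^ 2 := by
    intro v
    rw [Submodule.norm_sq_eq_add_norm_sq_projection v (ℂ ∙ ν)]
    have h1 : ((ℂ ∙ ν).orthogonalProjectionOnto v : En n) = ⟪ν, v⟫_ℂ • ν :=
      Submodule.starProjection_unit_singleton ℂ hν v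
    rw [← Submodule.norm_coe ((ℂ ∙ ν).orthogonalProjectionOnto v), h1, norm_smul, hν, mul_one]
  have hanti : AntilipschitzWith 2 fun x : A => P x := by
    refine AntilipschitzWith.of_le_mul_dist fun x y => ?_
    have h1 := hA y y.2 x x.2
    have h2 := hnorm (x - y)
    rw [Subtype.dist_eq, dist_eq_norm, dist_eq_norm, ← map_sub]
    have h3 : ‖(x : En n) - y‖ ^ 2 ≤ (2 * ‖P (x - y)‖) ^ 2 := by
      nlinarith [norm_nonneg ⟪ν, (x : En n) - y⟫_ℂ, norm_nonneg ((x : En n) - y)]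
    simpa using (pow_le_pow_iff_left₀ (norm_nonneg _) (by positivity) two_ne_zero).1 h3
  have h1 := hanti.le_hausdorffMeasure_image hd univ
  rw [← (isometry_subtype_coe (s := A)).hausdorffMeasure_image (Or.inl hd), image_univ,
    Subtype.range_coe, image_univ, show (range fun x : A => P x) = P '' A by ext; simp] at h1
  exact h1

theorem exists_hausdorffMeasure_le (n : ℕ) (hn : n ≠ 0) :
    ∃ C : ℝ≥0∞, C ≠ ⊤ ∧ ∀ (A : Set (En n)) (z : En n) (r : ℝ), 0 < r → A ⊆ ball z r →
      (∀ x ∈ A, ∃ ν : En n, ‖ν‖ = 1 ∧ ∀ y ∈ A, ‖⟪ν, y - x⟫_ℂ‖ ≤ 1 / 4 * ‖y - x‖) →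
      μH[(2 * n - 2 : ℝ)] A ≤ C * ENNReal.ofReal (r ^ (2 * (n - 1))) := by
  have hn1 : (1 : ℝ) ≤ n := by exact_mod_cast Nat.one_le_iff_ne_zero.2 hn
  have hd : (0 : ℝ) ≤ 2 * n - 2 := by linarith
  obtain ⟨t, hts, htf, htc⟩ := (isCompact_sphere (0 : En n) 1).finite_cover_balls
    (e := 1 / 4) (by norm_num)
  have hfin : ∀ ν ∈ t, Module.finrank ℝ (ℂ ∙ ν)ᗮ = 2 * (n - 1) := by
    intro ν hν
    have hν0 : ν ≠ 0 := by
      rintro rfl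
      simpa using hts hν
    have : Fact (Module.finrank ℂ (En n) = (n - 1) + 1) := ⟨by simp; omega⟩
    rw [finrank_real_of_complex, Submodule.finrank_orthogonal_span_singleton (n := n - 1) hν0]
  have hball : ∀ ν ∈ t, ∃ c : ℝ≥0∞, c ≠ ⊤ ∧ ∀ (y : (ℂ ∙ ν)ᗮ) (r : ℝ), 0 < r →
      μH[(2 * n - 2 : ℝ)] (ball y r) = ENNReal.ofReal (r ^ (2 * (n - 1))) * c := by
    intro ν hν
    have hcast : (2 * n - 2 : ℝ) = (Module.finrank ℝ (ℂ ∙ ν)ᗮ : ℝ) := by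
      rw [hfin ν hν]
      push_cast [Nat.one_le_iff_ne_zero.2 hn]
      ring
    rw [hcast]
    refine ⟨μH[(Module.finrank ℝ (ℂ ∙ ν)ᗮ : ℝ)] (ball (0 : (ℂ ∙ ν)ᗮ) 1),
      measure_ball_lt_top.ne, fun y r hr => ?_⟩
    rw [Measure.addHaar_ball_of_pos _ _ hr, hfin ν hν]
  choose! c hct hc using hball
  refine ⟨∑ ν ∈ htf.toFinset, (2 : ℝ≥0∞) ^ (2 * n - 2 : ℝ) * c ν, ?_, ?_⟩
  · refine (ENNReal.sum_lt_top.2 fun ν hν => ?_).ne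
    exact ENNReal.mul_lt_top (ENNReal.rpow_lt_top_of_nonneg hd (by simp))
      (hct ν (htf.mem_toFinset.1 hν)).lt_top
  intro A z r hr hAr hA
  set B : En n → Set (En n) := fun ν =>
    {x ∈ A | ∀ y ∈ A, ‖⟪ν, y - x⟫_ℂ‖ ≤ 1 / 2 * ‖y - x‖} with hB
  have hcov : A ⊆ ⋃ ν ∈ htf.toFinset, B ν := by
    intro x hx
    obtain ⟨ν', hν', hxν⟩ := hA x hx
    obtain ⟨ν, hν, hνν⟩ := mem_iUnion₂.1 (htc (show ν' ∈ sphere (0 : En n) 1 by simpa using hν'))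
    refine mem_iUnion₂.2 ⟨ν, htf.mem_toFinset.2 hν, hx, fun y hy => ?_⟩
    have h1 : ⟪ν, y - x⟫_ℂ = ⟪ν', y - x⟫_ℂ - ⟪ν' - ν, y - x⟫_ℂ := by
      rw [inner_sub_left]; ring
    have h2 : ‖⟪ν' - ν, y - x⟫_ℂ‖ ≤ 1 / 4 * ‖y - x‖ :=
      (norm_inner_le_norm _ _).trans
        (mul_le_mul_of_nonneg_right (mem_ball_iff_norm.1 hνν).le (norm_nonneg _))
    rw [h1]
    linarith [norm_sub_le ⟪ν', y - x⟫_ℂ ⟪ν' - ν, y - x⟫_ℂ, hxν y hy]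
  calc μH[(2 * n - 2 : ℝ)] A ≤ μH[(2 * n - 2 : ℝ)] (⋃ ν ∈ htf.toFinset, B ν) := measure_mono hcov
    _ ≤ ∑ ν ∈ htf.toFinset, μH[(2 * n - 2 : ℝ)] (B ν) := measure_biUnion_finset_le _ _
    _ ≤ ∑ ν ∈ htf.toFinset, (2 : ℝ≥0∞) ^ (2 * n - 2 : ℝ) * c ν *
          ENNReal.ofReal (r ^ (2 * (n - 1))) := by
        refine Finset.sum_le_sum fun ν hν => ?_
        have hνt := htf.mem_toFinset.1 hν
        refine (hausdorffMeasure_le_of_norm_inner_le hd (by simpa using hts hνt)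
          fun x hx y hy => hx.2 y hy.1).trans ?_
        rw [mul_assoc, mul_comm (c ν),
          ← hc ν hνt ((ℂ ∙ ν)ᗮ.orthogonalProjectionOnto z) r hr]
        gcongr
        rintro _ ⟨x, hx, rfl⟩
        rw [mem_ball_iff_norm, ← map_sub]
        exact ((ℂ ∙ ν)ᗮ.norm_orthogonalProjectionOnto_apply_le _).trans_lt
          (mem_ball_iff_norm.1 (hAr hx.1))
    _ = _ := by rw [Finset.sum_mul]

end Area

theorem exists_surf_ball_le (n : ℕ) (hn : n ≠ 0) :
    ∃ S > (0 : ℝ), ∀ (ε₀ : ℝ) (T : En n → ℂ) (W : Set (En n)),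
      Differentiable ℂ T → (∀ z ∈ W, T z = 0) → (∀ z ∈ W, fderiv ℂ T z ≠ 0) →
      UniformlyFlatWith ε₀ W → ∀ (z : En n) (r : ℝ), 0 < r → r ≤ ε₀ / 8 →
        surf n W (ball z r) ≤ ENNReal.ofReal (S * r ^ (2 * (n - 1))) := by
  obtain ⟨C, hC, hA⟩ := exists_hausdorffMeasure_le n hn
  set κ : ℝ≥0∞ := (2 : ℝ≥0∞) ^ (n - 1) * (Nat.factorial (n - 1) : ℝ≥0∞) with hκ
  have hκC : κ * C ≠ ⊤ :=
    ENNReal.mul_ne_top (ENNReal.mul_ne_top (by simp) (ENNReal.natCast_ne_top _)) hC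
  refine ⟨(κ * C).toReal + 1, by positivity, fun ε₀ T W hT hTW hT0 hW z r hr hrε => ?_⟩
  have hball := hA (ball z r ∩ W) z r hr inter_subset_left fun x hx => by
    obtain ⟨ν, hν, hν'⟩ := exists_unit_normal hW hx.2 (hT x) hTW (hT0 x hx.2)
    refine ⟨ν, hν, fun y hy => (hν' y hy.2).trans ?_⟩
    have hyx : ‖y - x‖ ≤ 2 * r := by
      rw [← dist_eq_norm]
      linarith [dist_triangle_right y x z, mem_ball.1 hx.1, mem_ball.1 hy.1]
    rw [div_le_iff₀ hW.1]
    nlinarith [norm_nonneg (y - x)]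
  rw [surf, Measure.smul_apply, Measure.restrict_apply isOpen_ball.measurableSet, smul_eq_mul]
  calc κ * μH[(2 * n - 2 : ℝ)] (ball z r ∩ W)
      ≤ κ * (C * ENNReal.ofReal (r ^ (2 * (n - 1)))) := by gcongr
    _ = ENNReal.ofReal ((κ * C).toReal) * ENNReal.ofReal (r ^ (2 * (n - 1))) := by
        rw [ENNReal.ofReal_toReal hκC, mul_assoc κ]
    _ ≤ ENNReal.ofReal ((κ * C).toReal + 1) * ENNReal.ofReal (r ^ (2 * (n - 1))) := by
        gcongr
        linarith
    _ = _ := by rw [ENNReal.ofReal_mul (by positivity)]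

/-- Integrating a submean value inequality over `W` and exchanging the order of integration. -/
theorem lintegral_mul_le_of_submean {X : Type*} [PseudoMetricSpace X] [MeasurableSpace X]
    [OpensMeasurableSpace X] [SecondCountableTopology X] {μ σ : Measure X} [SFinite μ] [SFinite σ]
    {W U : Set X} (hW : MeasurableSet W) (hU : MeasurableSet U) {r : ℝ}
    (hWU : ∀ w ∈ W, ball w r ⊆ U) {h : X → ℝ≥0∞} (hh : Measurable (U.indicator h))
    {a b s : ℝ≥0∞} (ha : a ≠ ⊤) (hb : b ≠ ⊤) (hs : s ≠ ⊤) (hσ : ∀ z, σ (ball z r) ≤ s)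
    (hsub : ∀ w ∈ W, h w * a ≤ b * ∫⁻ z in ball w r, h z ∂μ) :
    (∫⁻ w in W, h w ∂σ) * a ≤ b * (s * ∫⁻ z in U, h z ∂μ) := by
  have hDm : MeasurableSet {q : X × X | dist q.2 q.1 < r} :=
    (isOpen_lt (continuous_snd.dist continuous_fst) continuous_const).measurableSet
  set k : X → X → ℝ≥0∞ := fun w z =>
    {q : X × X | dist q.2 q.1 < r}.indicator (fun q => U.indicator h q.2) (w, z) with hk
  have hkm : Measurable (Function.uncurry k) := (hh.comp measurable_snd).indicator hDm
  have hkball : ∀ w ∈ W, ∫⁻ z in ball w r, h z ∂μ = ∫⁻ z, k w z ∂μ := by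
    intro w hw
    rw [← lintegral_indicator measurableSet_ball]
    refine lintegral_congr fun z => ?_
    by_cases hz : dist z w < r
    · simp [hk, hz, hWU w hw hz]
    · simp [hk, hz]
  calc (∫⁻ w in W, h w ∂σ) * a = ∫⁻ w in W, h w * a ∂σ := (lintegral_mul_const' _ _ ha).symm
    _ ≤ ∫⁻ w in W, b * ∫⁻ z, k w z ∂μ ∂σ :=
        setLIntegral_mono' hW fun w hw => (hkball w hw) ▸ hsub w hw
    _ = b * ∫⁻ w in W, ∫⁻ z, k w z ∂μ ∂σ := lintegral_const_mul' _ _ hb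
    _ ≤ b * ∫⁻ w, ∫⁻ z, k w z ∂μ ∂σ := by gcongr; exact Measure.restrict_le_self
    _ = b * ∫⁻ z, ∫⁻ w, k w z ∂σ ∂μ := by rw [lintegral_lintegral_swap hkm.aemeasurable]
    _ ≤ b * ∫⁻ z, s * U.indicator h z ∂μ := by
        gcongr with z
        calc ∫⁻ w, k w z ∂σ = ∫⁻ w, (ball z r).indicator (fun _ => U.indicator h z) w ∂σ := by
              refine lintegral_congr fun w => ?_
              by_cases hz : dist z w < r
              · simp [hk, hz, dist_comm w z]
              · simp [hk, hz, dist_comm w z]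
          _ = U.indicator h z * σ (ball z r) := lintegral_indicator_const measurableSet_ball _
          _ ≤ s * U.indicator h z := by rw [mul_comm]; gcongr; exact hσ z
    _ = b * (s * ∫⁻ z in U, h z ∂μ) := by
        rw [lintegral_const_mul' _ _ hs, lintegral_indicator hU]

theorem restriction_estimate_of_surf_ball_le {n : ℕ} (hn : n ≠ 0) {S : ℝ} (hS : 0 < S)
    {p M ε ε₀ : ℝ} (hp : 0 < p) (hM0 : 0 ≤ M) (hε : 0 < ε) (hεε₀ : ε ≤ ε₀) {W : Set (En n)}
    (hW : IsClosed W)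
    (hσ : ∀ (z : En n) (r : ℝ), 0 < r → r ≤ ε₀ / 8 →
      surf n W (ball z r) ≤ ENNReal.ofReal (S * r ^ (2 * (n - 1))))
    {φ : En n → ℝ} (hφ : ContDiff ℝ 2 φ) (hM : ∀ z v : En n, levi φ z v ≤ M * ‖v‖ ^ 2)
    {F : En n → ℂ} (hF : DifferentiableOn ℂ F {z : En n | infDist z W < ε}) :
    ENNReal.ofReal ((vol n (ball 0 1)).toReal / (64 * Real.exp (p * M * ε₀ ^ 2) * S) * ε ^ 2) *
        ∫⁻ z in W, ENNReal.ofReal (‖F z‖ ^ p * Real.exp (-(p * φ z))) ∂(surf n W) ≤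
      ∫⁻ z in {z : En n | infDist z W < ε},
        ENNReal.ofReal (‖F z‖ ^ p * Real.exp (-(p * φ z))) ∂(vol n) := by
  set h : En n → ℝ≥0∞ := fun z => ENNReal.ofReal (‖F z‖ ^ p * Real.exp (-(p * φ z))) with hh
  set U : Set (En n) := {z | infDist z W < ε} with hU
  have hUo : IsOpen U := isOpen_infDist_lt ε W
  have hhm : Measurable (U.indicator h) := by
    classical
    rw [← Set.piecewise_eq_indicator]
    have hφc := hφ.continuous
    refine ContinuousOn.measurable_piecewise (ENNReal.continuous_ofReal.comp_continuousOn ?_)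
      continuousOn_const hUo.measurableSet
    refine (hF.continuousOn.norm.rpow_const fun _ _ => Or.inr hp.le).mul ?_
    exact (show Continuous fun z => Real.exp (-(p * φ z)) by fun_prop).continuousOn
  have hr : 0 < ε / 8 := by positivity
  have hrε : ε / 8 ≤ ε₀ / 8 := by linarith
  have hWU : ∀ w ∈ W, ball w (ε / 8) ⊆ U := fun w hw z hz =>
    (infDist_le_dist_of_mem hw).trans_lt ((mem_ball.1 hz).trans (by linarith))
  have : IsLocallyFiniteMeasure (surf n W) := ⟨fun z => ⟨ball z (ε / 8), ball_mem_nhds z hr,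
    (hσ z _ hr hrε).trans_lt ENNReal.ofReal_lt_top⟩⟩
  have key := lintegral_mul_le_of_submean (μ := vol n) (σ := surf n W) hW.measurableSet
    hUo.measurableSet hWU hhm (measure_ball_lt_top (x := (0 : En n)) (r := ε / 8)).ne
    ENNReal.ofReal_ne_top ENNReal.ofReal_ne_top (fun z => hσ z _ hr hrε)
    fun w hw => weighted_rpow_mul_vol_ball_le hp hM0 hφ hM (hF.mono (hWU w hw))
  set I := ∫⁻ z in W, h z ∂(surf n W)
  set J := ∫⁻ z in U, h z ∂(vol n)
  set v := (vol n (ball 0 1)).toReal with hv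
  set e := Real.exp (p * M * ε₀ ^ 2) with he
  have he0 : 0 < e := Real.exp_pos _
  set ρ := (ε / 8) ^ (2 * (n - 1)) with hρ
  have hρ0 : 0 < ρ := by positivity
  have hvol : vol n (ball 0 (ε / 8)) = ENNReal.ofReal (ρ * (ε / 8) ^ 2 * v) := by
    rw [Measure.addHaar_ball_of_pos _ _ hr, finrank_real_of_complex, finrank_euclideanSpace_fin,
      ENNReal.ofReal_mul (by positivity), hv, ENNReal.ofReal_toReal measure_ball_lt_top.ne, hρ,
      ← pow_add]
    congr 4
    omega
  have hexp : Real.exp (p * M * (ε / 8) ^ 2) ≤ e := by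
    rw [he]
    gcongr
    linarith
  calc ENNReal.ofReal (v / (64 * e * S) * ε ^ 2) * I
      = ENNReal.ofReal (1 / (e * (S * ρ))) * (I * vol n (ball 0 (ε / 8))) := by
        rw [hvol, mul_comm I, ← mul_assoc, ← ENNReal.ofReal_mul (by positivity)]
        congr 2
        field_simp
        norm_num
    _ ≤ ENNReal.ofReal (1 / (e * (S * ρ))) *
          (ENNReal.ofReal e * (ENNReal.ofReal (S * ρ) * J)) := by
        refine mul_le_mul' le_rfl (key.trans ?_)
        gcongr
    _ = J := by
        rw [← mul_assoc, ← mul_assoc, ← ENNReal.ofReal_mul (by positivity),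
          ← ENNReal.ofReal_mul (by positivity)]
        rw [show 1 / (e * (S * ρ)) * e * (S * ρ) = 1 by field_simp, ENNReal.ofReal_one, one_mul]

/-- **Proposition (restriction estimate).**  Let `W = T⁻¹(0)` be uniformly flat with
tubular radius `ε₀`, `1 ≤ p < ∞`, and let `φ` be `C²` plurisubharmonic with
`i∂∂̄φ ≤ Mω`.  There is `C > 0`, depending only on `p`, `M` and `ε₀`, such that for all
`0 < ε ≤ ε₀` and all `F` holomorphic on `N_ε(W)`,
`C ε² ∫_W |F|^p e^{-pφ} dσ ≤ ∫_{N_ε(W)} |F|^p e^{-pφ} dV`. -/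
theorem restriction_estimate
    (n : ℕ) (ε₀ : ℝ) (p : ℝ) (hp : 1 ≤ p) (M : ℝ) (hM : 0 < M) :
    ∃ C > (0 : ℝ), ∀ ε : ℝ, 0 < ε → ε ≤ ε₀ →
      ∀ (T : En n → ℂ) (W : Set (En n)) (φ : En n → ℝ),
      Differentiable ℂ T → W = T ⁻¹' {0} → (∀ z ∈ W, fderiv ℂ T z ≠ 0) →
      UniformlyFlatWith ε₀ W →
      ContDiff ℝ 2 φ → (∀ z v : En n, 0 ≤ levi φ z v) →
      (∀ z v : En n, levi φ z v ≤ M * ‖v‖ ^ 2) →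
      ∀ F : En n → ℂ, DifferentiableOn ℂ F {z : En n | Metric.infDist z W < ε} →
        ENNReal.ofReal (C * ε ^ 2) *
            ∫⁻ z in W, ENNReal.ofReal (‖F z‖ ^ p * Real.exp (-(p * φ z))) ∂(surf n W) ≤
          ∫⁻ z in {z : En n | Metric.infDist z W < ε},
            ENNReal.ofReal (‖F z‖ ^ p * Real.exp (-(p * φ z))) ∂(vol n) := by
  rcases eq_or_ne n 0 with rfl | hn
  · refine ⟨1, one_pos, fun ε _ _ T W φ _ _ hT0 _ _ _ _ F _ => ?_⟩
    have hW : W = ∅ := eq_empty_of_forall_notMem fun z hz => hT0 z hz (Subsingleton.elim _ _)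
    simp [hW]
  obtain ⟨S, hS, hsurf⟩ := exists_surf_ball_le n hn
  have hv : 0 < (vol n (ball 0 1)).toReal :=
    ENNReal.toReal_pos (measure_ball_pos _ _ one_pos).ne' measure_ball_lt_top.ne
  refine ⟨(vol n (ball 0 1)).toReal / (64 * Real.exp (p * M * ε₀ ^ 2) * S), by positivity, ?_⟩
  intro ε hε hεε₀ T W φ hT hTW hT0 hflat hφ _ hlevi F hF
  have hW0 : ∀ z ∈ W, T z = 0 := fun z hz => by simpa [hTW] using hz
  have hWc : IsClosed W := hTW ▸ isClosed_singleton.preimage hT.continuous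
  exact restriction_estimate_of_surf_ball_le hn hS (by linarith) hM.le hε hεε₀ hWc
    (hsurf ε₀ T W hT hW0 hT0 hflat) hφ hlevi hF
end
end

section
/- Let W ⊂ ℂⁿ be a uniformly flat smooth closed complex hypersurface, let 1 ≤ p < ∞, and let φ be a C² plurisubharmonic function on ℂⁿ with i∂∂̄φ ≤ Mω. Then there is a constant M' > 1 such that for every F ∈ BF^p_φ(ℂⁿ), ∫_W |F|^p e^{-pφ} dσ ≤ M' ∫_{ℂⁿ} |F|^p e^{-pφ} dV. -/
open MeasureTheory Metric Set
open scoped ENNReal NNReal Topology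

noncomputable section

/-- Divergence theorem in polar coordinates, on the real plane swept by a parametrized circle. -/
theorem integral_fderiv_circle_le {E : Type*} [NormedAddCommGroup E] [NormedSpace ℝ E]
    {φ : E → ℝ} (hφ : ContDiff ℝ 2 φ) {A : ℝ} {e e' : ℝ → E}
    (he : ContDiff ℝ 1 e) (he' : ContDiff ℝ 1 e')
    (hd : ∀ θ, HasDerivAt e (e' θ) θ) (hd' : ∀ θ, HasDerivAt e' (-e θ) θ)
    (hp : e (2 * Real.pi) = e 0) (hp' : e' (2 * Real.pi) = e' 0)
    (hbd : ∀ z θ, fderiv ℝ (fderiv ℝ φ) z (e θ) (e θ) +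
      fderiv ℝ (fderiv ℝ φ) z (e' θ) (e' θ) ≤ 4 * A) (w : E) {R : ℝ} (hR : 0 < R) :
    ∫ θ in (0 : ℝ)..2 * Real.pi, fderiv ℝ φ (w + R • e θ) (e θ) ≤ 4 * Real.pi * A * R := by
  have hD : ContDiff ℝ 1 (fderiv ℝ φ) := hφ.fderiv_right (by norm_num)
  set f : ℝ × ℝ → ℝ := fun x => fderiv ℝ φ (w + x.1 • e x.2) (x.1 • e x.2) with hf
  set g : ℝ × ℝ → ℝ := fun x => fderiv ℝ φ (w + x.1 • e x.2) (e' x.2) with hg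
  have he2 : ContDiff ℝ 1 (fun x : ℝ × ℝ => e x.2) := he.comp contDiff_snd
  have hfc : ContDiff ℝ 1 f :=
    (hD.comp (contDiff_const.add (contDiff_fst.smul he2))).clm_apply (contDiff_fst.smul he2)
  have hgc : ContDiff ℝ 1 g :=
    (hD.comp (contDiff_const.add (contDiff_fst.smul he2))).clm_apply (he'.comp contDiff_snd)
  have hfd : ∀ x, HasFDerivAt f (fderiv ℝ f x) x := fun x =>
    (hfc.differentiable one_ne_zero x).hasFDerivAt
  have hgd : ∀ x, HasFDerivAt g (fderiv ℝ g x) x := fun x =>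
    (hgc.differentiable one_ne_zero x).hasFDerivAt
  have hDd : ∀ z, HasFDerivAt (fderiv ℝ φ) (fderiv ℝ (fderiv ℝ φ) z) z := fun z =>
    (hD.differentiable one_ne_zero z).hasFDerivAt
  have hlap : ∀ r θ : ℝ, fderiv ℝ f (r, θ) (1, 0) + fderiv ℝ g (r, θ) (0, 1) =
      r * (fderiv ℝ (fderiv ℝ φ) (w + r • e θ) (e θ) (e θ) +
        fderiv ℝ (fderiv ℝ φ) (w + r • e θ) (e' θ) (e' θ)) := by
    intro r θ
    have h1 : fderiv ℝ f (r, θ) (1, 0) =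
        fderiv ℝ (fderiv ℝ φ) (w + r • e θ) (e θ) (r • e θ) +
        fderiv ℝ φ (w + r • e θ) (e θ) := by
      have hl : HasDerivAt (fun s : ℝ => (s, θ)) ((1 : ℝ), (0 : ℝ)) r :=
        (hasDerivAt_id r).prodMk (hasDerivAt_const r θ)
      have ha := (hfd (r, θ)).comp_hasDerivAt r hl
      have hu : HasDerivAt (fun s : ℝ => s • e θ) (e θ) r := by
        simpa using (hasDerivAt_id r).smul_const (e θ)
      have hc : HasDerivAt (fun s : ℝ => fderiv ℝ φ (w + s • e θ))
          (fderiv ℝ (fderiv ℝ φ) (w + r • e θ) (e θ)) r :=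
        HasFDerivAt.comp_hasDerivAt (l := fderiv ℝ φ) (f := fun s : ℝ => w + s • e θ) r
          (hDd (w + r • e θ)) (hu.const_add w)
      exact ha.unique (hc.clm_apply hu)
    have h2 : fderiv ℝ g (r, θ) (0, 1) =
        fderiv ℝ (fderiv ℝ φ) (w + r • e θ) (r • e' θ) (e' θ) +
        fderiv ℝ φ (w + r • e θ) (-e θ) := by
      have hl : HasDerivAt (fun s : ℝ => (r, s)) ((0 : ℝ), (1 : ℝ)) θ :=
        (hasDerivAt_const θ r).prodMk (hasDerivAt_id θ)
      have ha := (hgd (r, θ)).comp_hasDerivAt θ hl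
      have hc : HasDerivAt (fun s : ℝ => fderiv ℝ φ (w + r • e s))
          (fderiv ℝ (fderiv ℝ φ) (w + r • e θ) (r • e' θ)) θ :=
        HasFDerivAt.comp_hasDerivAt (l := fderiv ℝ φ) (f := fun s : ℝ => w + r • e s) θ
          (hDd (w + r • e θ)) (((hd θ).const_smul r).const_add w)
      exact ha.unique (hc.clm_apply (hd' θ))
    rw [h1, h2]
    simp only [map_neg, map_smul, smul_apply, smul_eq_mul]
    ring
  have hlapc : Continuous (fun x : ℝ × ℝ => x.1 *
      (fderiv ℝ (fderiv ℝ φ) (w + x.1 • e x.2) (e x.2) (e x.2) +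
        fderiv ℝ (fderiv ℝ φ) (w + x.1 • e x.2) (e' x.2) (e' x.2))) := by
    have h1 := hfc.continuous_fderiv one_ne_zero
    have h2 := hgc.continuous_fderiv one_ne_zero
    simp only [← hlap]
    fun_prop
  have hdiv := integral2_divergence_prod_of_hasFDerivAt f g (fderiv ℝ f) (fderiv ℝ g) 0 0 R
    (2 * Real.pi) hfc.continuous.continuousOn hgc.continuous.continuousOn
    (fun x _ => hfd x) (fun x _ => hgd x) (by
      simp only [fun x : ℝ × ℝ => hlap x.1 x.2]
      exact hlapc.continuousOn.integrableOn_compact (isCompact_uIcc.prod isCompact_uIcc))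
  have hper : ∀ x : ℝ, g (x, 2 * Real.pi) = g (x, 0) := by
    intro x
    simp only [hg, hp, hp']
  have hf0 : ∀ y : ℝ, f (0, y) = 0 := by intro y; simp [hf]
  simp only [hper, hf0, sub_self, zero_add, intervalIntegral.integral_zero, sub_zero, hlap] at hdiv
  have hinner : ∀ r ∈ Icc (0 : ℝ) R, ∫ y in (0 : ℝ)..2 * Real.pi,
      r * (fderiv ℝ (fderiv ℝ φ) (w + r • e y) (e y) (e y) +
        fderiv ℝ (fderiv ℝ φ) (w + r • e y) (e' y) (e' y)) ≤ 8 * Real.pi * A * r := by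
    intro r hr
    have h2pi : (0 : ℝ) ≤ 2 * Real.pi := by positivity
    refine (intervalIntegral.integral_mono_on (g := fun _ => r * (4 * A)) h2pi
      ((hlapc.comp (continuous_const.prodMk continuous_id)).intervalIntegrable _ _) (by simp)
      fun y _ => mul_le_mul_of_nonneg_left (hbd _ _) hr.1).trans_eq ?_
    simp
    ring
  have hle : R * ∫ θ in (0 : ℝ)..2 * Real.pi, fderiv ℝ φ (w + R • e θ) (e θ) ≤
      R * (4 * Real.pi * A * R) := by
    rw [← intervalIntegral.integral_const_mul]
    have : ∀ θ, R * fderiv ℝ φ (w + R • e θ) (e θ) = f (R, θ) := by intro θ; simp [hf]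
    simp only [this]
    rw [← hdiv]
    refine (intervalIntegral.integral_mono_on hR.le ?_ ?_ hinner).trans_eq ?_
    · exact (intervalIntegral.continuous_parametric_intervalIntegral_of_continuous' hlapc
        _ _).intervalIntegrable _ _
    · exact Continuous.intervalIntegrable (by fun_prop) _ _
    · rw [intervalIntegral.integral_const_mul, integral_id]
      ring
  exact le_of_mul_le_mul_left hle hR

/-- The mean of a `C²` function over a circle exceeds the value at the centre by at most the
supremum of a quarter of the Laplacian. -/
theorem integral_circle_le {E : Type*} [NormedAddCommGroup E] [NormedSpace ℝ E]
    {φ : E → ℝ} (hφ : ContDiff ℝ 2 φ) {A : ℝ} {e e' : ℝ → E}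
    (he : ContDiff ℝ 1 e) (he' : ContDiff ℝ 1 e')
    (hd : ∀ θ, HasDerivAt e (e' θ) θ) (hd' : ∀ θ, HasDerivAt e' (-e θ) θ)
    (hp : e (2 * Real.pi) = e 0) (hp' : e' (2 * Real.pi) = e' 0)
    (hbd : ∀ z θ, fderiv ℝ (fderiv ℝ φ) z (e θ) (e θ) +
      fderiv ℝ (fderiv ℝ φ) z (e' θ) (e' θ) ≤ 4 * A) (w : E) :
    ∫ θ in (0 : ℝ)..2 * Real.pi, φ (w + e θ) ≤ 2 * Real.pi * (φ w + A) := by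
  have hD : Continuous (fderiv ℝ φ) := hφ.continuous_fderiv (by norm_num)
  have hcont : Continuous (fun x : ℝ × ℝ => fderiv ℝ φ (w + x.1 • e x.2) (e x.2)) := by
    have h2 : Continuous (fun x : ℝ × ℝ => e x.2) := he.continuous.comp continuous_snd
    exact (hD.comp (continuous_const.add (continuous_fst.smul h2))).clm_apply h2
  have hftc : ∀ θ : ℝ, φ (w + e θ) - φ w =
      ∫ r in (0 : ℝ)..1, fderiv ℝ φ (w + r • e θ) (e θ) := by
    intro θ
    have := intervalIntegral.integral_eq_sub_of_hasDerivAt (a := 0) (b := 1)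
      (f := fun r : ℝ => φ (w + r • e θ)) (f' := fun r : ℝ => fderiv ℝ φ (w + r • e θ) (e θ))
      (fun r _ => by
        have hu : HasDerivAt (fun s : ℝ => w + s • e θ) (e θ) r := by
          simpa using ((hasDerivAt_id r).smul_const (e θ)).const_add w
        exact ((hφ.differentiable (by norm_num)) _).hasFDerivAt.comp_hasDerivAt r hu)
      (Continuous.intervalIntegrable
        (hcont.comp (continuous_id.prodMk continuous_const)) _ _)
    rw [this]; simp
  have hint : IntervalIntegrable (fun θ => φ (w + e θ)) volume 0 (2 * Real.pi) :=
    (hφ.continuous.comp (continuous_const.add he.continuous)).intervalIntegrable _ _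
  have hmain : (∫ θ in (0 : ℝ)..2 * Real.pi, φ (w + e θ)) - 2 * Real.pi * φ w ≤
      2 * Real.pi * A := by
    have h1 : (∫ θ in (0 : ℝ)..2 * Real.pi, φ (w + e θ)) - 2 * Real.pi * φ w =
        ∫ θ in (0 : ℝ)..2 * Real.pi, (φ (w + e θ) - φ w) := by
      rw [intervalIntegral.integral_sub hint (by simp)]
      simp
    rw [h1]
    simp only [hftc]
    rw [intervalIntegral_intervalIntegral_swap]
    · refine (intervalIntegral.integral_mono_on_of_le_Ioo (a := (0 : ℝ)) (b := 1)
        (g := fun r => 4 * Real.pi * A * r) zero_le_one ?_ ?_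
        (fun r hr => integral_fderiv_circle_le hφ he he' hd hd' hp hp' hbd w hr.1)).trans_eq ?_
      · exact (intervalIntegral.continuous_parametric_intervalIntegral_of_continuous' hcont
          _ _).intervalIntegrable _ _
      · exact Continuous.intervalIntegrable (by fun_prop) _ _
      · rw [intervalIntegral.integral_const_mul, integral_id]
        ring
    · refine IntegrableOn.mono_set ?_ (prod_mono uIoc_subset_uIcc uIoc_subset_uIcc)
      exact (hcont.comp continuous_swap).continuousOn.integrableOn_compact
        (isCompact_uIcc.prod isCompact_uIcc)
  linarith

theorem circleAverage_le_of_levi_le {n : ℕ} {φ : En n → ℝ} (hφ : ContDiff ℝ 2 φ) {M : ℝ}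
    (hbd : ∀ z v : En n, levi φ z v ≤ M * ‖v‖ ^ 2) (w v : En n) :
    Real.circleAverage (fun ζ => φ (w + ζ • v)) 0 1 ≤ φ w + M * ‖v‖ ^ 2 := by
  have hd : ∀ θ : ℝ, HasDerivAt (fun s => circleMap 0 1 s • v)
      (Complex.I • circleMap 0 1 θ • v) θ := by
    intro θ
    have := (hasDerivAt_circleMap 0 1 θ).smul_const v
    rwa [mul_comm, mul_smul] at this
  have hd' : ∀ θ : ℝ, HasDerivAt (fun s => Complex.I • circleMap 0 1 s • v)
      (-(circleMap 0 1 θ • v)) θ := by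
    intro θ
    have := (hd θ).const_smul Complex.I
    rwa [smul_smul Complex.I, Complex.I_mul_I, neg_one_smul] at this
  have hp : circleMap 0 1 (2 * Real.pi) = circleMap 0 1 0 := by
    simpa using periodic_circleMap 0 1 0
  have hc : ContDiff ℝ 1 (fun θ => circleMap 0 1 θ • v) :=
    (contDiff_circleMap 0 1).smul contDiff_const
  have hE : ∀ θ, ‖circleMap 0 1 θ • v‖ = ‖v‖ := by intro θ; simp [norm_smul]
  rw [Real.circleAverage_def, smul_eq_mul, inv_mul_le_iff₀ (by positivity)]
  refine integral_circle_le hφ hc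
    (ContDiff.const_smul (c := Complex.I) (f := fun θ => circleMap 0 1 θ • v) hc) hd hd'
    (by simp [hp]) (by simp [hp])
    (fun z θ => ?_) w
  have := hbd z (circleMap 0 1 θ • v)
  rw [hE] at this
  simp only [levi, hess] at this
  linarith
/-- The sub-mean value property of `log ‖g‖` for a nonvanishing centre. -/
theorem log_norm_le_circleAverage_s12 {g : ℂ → ℂ} (hg : Differentiable ℂ g) (h0 : g 0 ≠ 0) :
    Real.log ‖g 0‖ ≤ Real.circleAverage (fun ζ => Real.log ‖g ζ‖) 0 1 := by
  have han : AnalyticOnNhd ℂ g (closedBall 0 |1|) := fun z _ => hg.analyticAt z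
  rw [han.circleAverage_log_norm one_ne_zero h0]
  refine le_add_of_nonneg_left (finsum_nonneg fun u => ?_)
  by_cases hu : u ∈ closedBall (0 : ℂ) |1|
  · refine mul_nonneg (mod_cast MeromorphicOn.AnalyticOnNhd.divisor_nonneg han ..) ?_
    rw [zero_sub, norm_neg, one_mul]
    rcases eq_or_ne u 0 with rfl | hne
    · simp
    · refine Real.log_nonneg ((one_le_inv₀ (by simpa using hne)).2 (by simpa using hu))
  · simp [Function.locallyFinsuppWithin.apply_eq_zero_of_notMem _ hu]

/-- Weighted sub-mean value inequality on a circle. -/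
theorem norm_rpow_mul_exp_le_circleAverage {g : ℂ → ℂ} (hg : Differentiable ℂ g) {χ : ℂ → ℝ}
    (hχ : Continuous χ) {p : ℝ} (hp : 0 < p) {B : ℝ} (hB : Real.circleAverage χ 0 1 ≤ B) :
    ‖g 0‖ ^ p * Real.exp (-(p * B)) ≤
      Real.circleAverage (fun ζ => ‖g ζ‖ ^ p * Real.exp (-(p * χ ζ))) 0 1 := by
  by_cases h0 : g 0 = 0
  · rw [h0, norm_zero, Real.zero_rpow hp.ne', zero_mul]
    exact Real.circleAverage_nonneg_of_nonneg fun ζ _ => by positivity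
  have hχi : CircleIntegrable χ 0 1 := hχ.continuousOn.circleIntegrable'
  have hli : CircleIntegrable (fun ζ => Real.log ‖g ζ‖) 0 1 :=
    MeromorphicOn.circleIntegrable_log_norm fun z _ => (hg.analyticAt z).meromorphicAt
  have hlog := log_norm_le_circleAverage_s12 hg h0
  set u : ℂ → ℝ := fun ζ => p * Real.log ‖g ζ‖ - p * χ ζ with hu
  have h1 : CircleIntegrable (fun ζ => p * Real.log ‖g ζ‖) 0 1 := hli.const_smul (a := p)
  have h2 : CircleIntegrable (fun ζ => p * χ ζ) 0 1 := hχi.const_smul (a := p)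
  have hui : CircleIntegrable u 0 1 := h1.sub h2
  set a : ℝ := p * Real.log ‖g 0‖ - p * B with ha
  have hua : a ≤ Real.circleAverage u 0 1 := by
    rw [hu, Real.circleAverage_fun_sub h1 h2]
    have e1 : Real.circleAverage (fun ζ => p * Real.log ‖g ζ‖) 0 1 =
      p * Real.circleAverage (fun ζ => Real.log ‖g ζ‖) 0 1 := Real.circleAverage_fun_smul (a := p)
    have e2 : Real.circleAverage (fun ζ => p * χ ζ) 0 1 =
      p * Real.circleAverage χ 0 1 := Real.circleAverage_fun_smul (a := p)
    rw [e1, e2, ha]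
    gcongr
  have hexp : ∀ ζ, g ζ ≠ 0 → ‖g ζ‖ ^ p * Real.exp (-(p * χ ζ)) = Real.exp (u ζ) := by
    intro ζ hζ
    rw [Real.rpow_def_of_pos (norm_pos_iff.2 hζ), ← Real.exp_add]
    congr 1
    simp only [hu]; ring
  have hcod : (fun ζ => ‖g ζ‖ ^ p * Real.exp (-(p * χ ζ)))
      =ᶠ[Filter.codiscreteWithin (sphere (0 : ℂ) |1|)] fun ζ => Real.exp (u ζ) := by
    have han : AnalyticOnNhd ℂ g univ := fun z _ => hg.analyticAt z
    have := Filter.codiscreteWithin_mono (subset_univ (sphere (0 : ℂ) |1|))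
      (han.preimage_zero_mem_codiscrete h0)
    filter_upwards [this] with ζ hζ
    exact hexp ζ (by simpa using hζ)
  have hci : CircleIntegrable (fun ζ => ‖g ζ‖ ^ p * Real.exp (-(p * χ ζ))) 0 1 := by
    refine Continuous.continuousOn ?_ |>.circleIntegrable'
    have := hg.continuous
    exact (this.norm.rpow_const fun _ => Or.inr hp.le).mul (by fun_prop)
  rw [Real.circleAverage_congr_codiscreteWithin hcod one_ne_zero]
  have h3 : CircleIntegrable (fun ζ => Real.exp a * u ζ) 0 1 := hui.const_smul (a := Real.exp a)
  have hli2 : CircleIntegrable (fun ζ => Real.exp a * (1 - a) + Real.exp a * u ζ) 0 1 :=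
    (circleIntegrable_const _ _ _).add h3
  have hmono := Real.circleAverage_mono hli2 (hci.congr_codiscreteWithin hcod) fun ζ _ => by
    have h := Real.add_one_le_exp (u ζ - a)
    have h' : Real.exp (u ζ) = Real.exp a * Real.exp (u ζ - a) := by
      rw [← Real.exp_add]; congr 1; ring
    rw [h']
    nlinarith [Real.exp_pos a]
  refine le_trans ?_ hmono
  rw [Real.circleAverage_fun_add (circleIntegrable_const _ _ _) h3, Real.circleAverage_const]
  have e3 : Real.circleAverage (fun ζ => Real.exp a * u ζ) 0 1 =
      Real.exp a * Real.circleAverage u 0 1 := Real.circleAverage_fun_smul (a := Real.exp a)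
  have e4 : ‖g 0‖ ^ p * Real.exp (-(p * B)) = Real.exp a := by
    rw [Real.rpow_def_of_pos (norm_pos_iff.2 h0), ← Real.exp_add]
    congr 1
    simp only [ha]; ring
  rw [e4, e3]
  nlinarith [Real.exp_pos a]

/-- A function satisfying a mean value inequality on the circles `w + S¹ • v` satisfies it on the
ball centred at `w`. -/
theorem const_mul_hausdorffMeasure_ball_le {E : Type*} [NormedAddCommGroup E] [NormedSpace ℂ E]
    [MeasurableSpace E] [BorelSpace E] [SecondCountableTopology E] {d : ℝ}
    [SFinite (μH[d] : Measure E)] {G : E → ℝ≥0∞} (hG : Measurable G) (w : E) (r : ℝ) (c : ℝ≥0∞)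
    (h : ∀ v ∈ ball (0 : E) r, c ≤ (ENNReal.ofReal (2 * Real.pi))⁻¹ *
      ∫⁻ θ in Ioc 0 (2 * Real.pi), G (w + circleMap 0 1 θ • v)) :
    c * μH[d] (ball (0 : E) r) ≤ ∫⁻ z in ball w r, G z ∂μH[d] := by
  set K := ENNReal.ofReal (2 * Real.pi) with hK
  have hK0 : K ≠ 0 := by simp [hK, Real.pi_pos]
  have hKt : K ≠ ⊤ := ENNReal.ofReal_ne_top
  have hmeas : Measurable fun q : E × ℝ => G (w + circleMap 0 1 q.2 • q.1) := by
    refine hG.comp (Continuous.measurable ?_)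
    have := continuous_circleMap 0 1
    fun_prop
  have key : ∀ θ : ℝ, ∫⁻ v in ball (0 : E) r, G (w + circleMap 0 1 θ • v) ∂μH[d] =
      ∫⁻ z in ball w r, G z ∂μH[d] := by
    intro θ
    have hn : ‖circleMap 0 1 θ‖ = 1 := by simp
    have hne : circleMap 0 1 θ ≠ 0 := norm_ne_zero_iff.1 (by simp [hn])
    let e : E ≃ᵢ E := IsometryEquiv.mk' (fun v => w + circleMap 0 1 θ • v)
      (fun z => (circleMap 0 1 θ)⁻¹ • (z - w)) (fun z => by simp [smul_smul, hne])
      (Isometry.of_dist_eq fun x y => by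
        rw [dist_add_left, dist_smul₀, hn, one_mul])
    have hpre : e ⁻¹' ball w r = ball 0 r := by
      ext v
      have : dist (w + circleMap 0 1 θ • v) w = dist v 0 := by
        rw [dist_eq_norm, add_sub_cancel_left, norm_smul, hn, one_mul, dist_zero_right]
      change dist (w + circleMap 0 1 θ • v) w < r ↔ dist v 0 < r
      rw [this]
    rw [← hpre]
    exact (e.measurePreserving_hausdorffMeasure d).setLIntegral_comp_preimage
      measurableSet_ball hG
  calc c * μH[d] (ball (0 : E) r) = ∫⁻ _ in ball (0 : E) r, c ∂μH[d] := by
        rw [setLIntegral_const]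
    _ ≤ ∫⁻ v in ball (0 : E) r, K⁻¹ * (∫⁻ θ in Ioc 0 (2 * Real.pi),
          G (w + circleMap 0 1 θ • v)) ∂μH[d] :=
        setLIntegral_mono' measurableSet_ball h
    _ = K⁻¹ * ∫⁻ θ in Ioc 0 (2 * Real.pi), (∫⁻ v in ball (0 : E) r,
          G (w + circleMap 0 1 θ • v) ∂μH[d]) := by
        rw [lintegral_const_mul' _ _ (ENNReal.inv_ne_top.2 hK0),
          lintegral_lintegral_swap hmeas.aemeasurable]
    _ = ∫⁻ z in ball w r, G z ∂μH[d] := by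
        simp_rw [key]
        rw [setLIntegral_const, Real.volume_Ioc, sub_zero, mul_comm _ (ENNReal.ofReal _), ← hK,
          ← mul_assoc, ENNReal.inv_mul_cancel hK0 hKt, one_mul]

theorem isAddHaarMeasure_vol_s12 (n : ℕ) : (vol n).IsAddHaarMeasure := by
  have h := isAddHaarMeasure_hausdorffMeasure (E := En n)
  have e : Module.finrank ℝ (En n) = 2 * n := by
    rw [finrank_real_of_complex, finrank_euclideanSpace_fin]
  rw [e] at h
  simpa [vol] using h

/-- Mean value inequality for the weighted function `|F|^p e^{-pφ}` on balls, up to the error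
coming from an upper bound on the Levi form of `φ`. -/
theorem weighted_mul_vol_ball_le {n : ℕ} {p : ℝ} (hp : 0 < p) {M : ℝ} (hM : 0 ≤ M)
    {φ : En n → ℝ} (hφ : ContDiff ℝ 2 φ) (hbd : ∀ z v : En n, levi φ z v ≤ M * ‖v‖ ^ 2)
    {F : En n → ℂ} (hF : Differentiable ℂ F) (w : En n) (r : ℝ) :
    ENNReal.ofReal (‖F w‖ ^ p * Real.exp (-(p * φ w))) *
        (ENNReal.ofReal (Real.exp (-(p * (M * r ^ 2)))) * vol n (ball 0 r)) ≤
      ∫⁻ z in ball w r, ENNReal.ofReal (‖F z‖ ^ p * Real.exp (-(p * φ z))) ∂(vol n) := by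
  have := isAddHaarMeasure_vol_s12 n
  have : SFinite (μH[(2 * n : ℝ)] : Measure (En n)) := inferInstanceAs (SFinite (vol n))
  have hcont : Continuous fun z => ‖F z‖ ^ p * Real.exp (-(p * φ z)) := by
    have h1 := hF.continuous
    have h2 := hφ.continuous
    exact (h1.norm.rpow_const fun _ => Or.inr hp.le).mul (by fun_prop)
  rw [← mul_assoc]
  refine const_mul_hausdorffMeasure_ball_le (d := 2 * n)
    hcont.measurable.ennreal_ofReal w r _ fun v hv => ?_
  have hline : Continuous fun ζ : ℂ => w + ζ • v := by fun_prop
  have hv' : ‖v‖ ^ 2 ≤ r ^ 2 :=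
    pow_le_pow_left₀ (norm_nonneg v) (by simpa using (mem_ball_zero_iff.1 hv).le) 2
  have hB := (circleAverage_le_of_levi_le hφ hbd w v).trans
    (add_le_add_right (mul_le_mul_of_nonneg_left hv' hM) (φ w))
  have hg : Differentiable ℂ fun ζ : ℂ => F (w + ζ • v) :=
    hF.comp ((differentiable_const w).add (differentiable_id.smul_const v))
  have hmean := norm_rpow_mul_exp_le_circleAverage hg (hφ.continuous.comp hline) hp hB
  have h0 : F (w + (0 : ℂ) • v) = F w := by rw [zero_smul, add_zero]
  simp only [h0] at hmean
  rw [← ENNReal.ofReal_mul (by positivity)]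
  have e1 : ‖F w‖ ^ p * Real.exp (-(p * φ w)) * Real.exp (-(p * (M * r ^ 2))) =
      ‖F w‖ ^ p * Real.exp (-(p * (φ w + M * r ^ 2))) := by
    rw [mul_assoc, ← Real.exp_add]; congr 2; ring
  rw [e1]
  refine (ENNReal.ofReal_le_ofReal hmean).trans_eq ?_
  have hc2 : Continuous fun θ => ‖F (w + circleMap 0 1 θ • v)‖ ^ p *
      Real.exp (-(p * φ (w + circleMap 0 1 θ • v))) :=
    hcont.comp (hline.comp (continuous_circleMap 0 1))
  rw [Real.circleAverage_def, smul_eq_mul, ENNReal.ofReal_mul (by positivity),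
    ENNReal.ofReal_inv_of_pos (by positivity), intervalIntegral.integral_of_le (by positivity),
    ofReal_integral_eq_lintegral_ofReal]
  · rfl
  · exact (hc2.intervalIntegrable 0 (2 * Real.pi)).1
  · exact Filter.Eventually.of_forall fun θ => by positivity

/-- Second order Taylor bound for holomorphic functions of several variables. -/
theorem exists_norm_sub_fderiv_le {E : Type*} [NormedAddCommGroup E] [NormedSpace ℂ E]
    {T : E → ℂ} (hT : Differentiable ℂ T) (w : E) :
    ∃ K, 0 ≤ K ∧ ∃ δ > 0, ∀ z ∈ ball w δ,
      ‖T z - T w - fderiv ℂ T w (z - w)‖ ≤ K * ‖z - w‖ ^ 2 := by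
  set f : E → ℂ := fun z => T z - fderiv ℂ T w z with hf
  have hfd : Differentiable ℂ f := hT.sub (fderiv ℂ T w).differentiable
  obtain ⟨δ, hδ, hmap⟩ := Metric.continuousAt_iff.1 (hfd w).continuousAt 1 one_pos
  have hlo : (fun z => f z - f w) =o[𝓝 w] fun z => ‖z - w‖ ^ 1 := by
    have h := (hT w).hasFDerivAt.isLittleO.norm_right
    refine h.congr (fun z => ?_) fun z => (pow_one _).symm
    simp only [hf, map_sub]; ring
  refine ⟨1 / δ ^ 2, by positivity, δ, hδ, fun z hz => ?_⟩
  have h := Complex.dist_le_mul_div_pow_of_mapsTo_ball_of_isLittleO (n := 1) (R₂ := 1)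
    hfd.differentiableOn (fun z hz => (hmap hz).le) hlo hz
  rw [dist_eq_norm, dist_eq_norm] at h
  calc ‖T z - T w - fderiv ℂ T w (z - w)‖ = ‖f z - f w‖ := by
        congr 1; simp only [hf, map_sub]; ring
    _ ≤ _ := h
    _ = 1 / δ ^ 2 * ‖z - w‖ ^ 2 := by ring

/-- Every point of the `ε`-neighbourhood of `W` has a unique nearest point on `W`, namely `pr z`. -/
def IsNearestPointMap {E : Type*} [PseudoMetricSpace E] (ε : ℝ) (W : Set E) (pr : E → E) : Prop :=
  ∀ z, infDist z W < ε →
    pr z ∈ W ∧ dist z (pr z) = infDist z W ∧ ∀ w ∈ W, dist z w = infDist z W → w = pr z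

namespace IsNearestPointMap

variable {E : Type*} [NormedAddCommGroup E] [NormedSpace ℝ E] {ε : ℝ} {W : Set E} {pr : E → E}

theorem infDist_segment (h : IsNearestPointMap ε W pr) {y : E} (hy : infDist y W < ε) {μ : ℝ}
    (h0 : 0 ≤ μ) (h1 : μ ≤ 1) : infDist (pr y + μ • (y - pr y)) W = μ * infDist y W := by
  obtain ⟨hc, hd, -⟩ := h y hy
  have hle : infDist (pr y + μ • (y - pr y)) W ≤ μ * infDist y W := by
    refine (infDist_le_dist_of_mem hc).trans_eq ?_
    rw [dist_eq_norm, add_sub_cancel_left, norm_smul, ← dist_eq_norm, hd, Real.norm_of_nonneg h0]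
  have hge := infDist_le_infDist_add_dist (s := W) (x := y) (y := pr y + μ • (y - pr y))
  have e : dist y (pr y + μ • (y - pr y)) = (1 - μ) * infDist y W := by
    have : y - (pr y + μ • (y - pr y)) = (1 - μ) • (y - pr y) := by module
    rw [dist_eq_norm, this, norm_smul, Real.norm_of_nonneg (by linarith), ← dist_eq_norm, hd]
  rw [e] at hge
  linarith

theorem pr_segment (h : IsNearestPointMap ε W pr) {y : E} (hy : infDist y W < ε) {μ : ℝ}
    (h0 : 0 ≤ μ) (h1 : μ ≤ 1) : pr (pr y + μ • (y - pr y)) = pr y := by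
  have hz := h.infDist_segment hy h0 h1
  obtain ⟨hc, hd, -⟩ := h y hy
  have h0' : 0 ≤ infDist y W := infDist_nonneg
  refine ((h _ ?_).2.2 (pr y) hc ?_).symm
  · rw [hz]; nlinarith
  · rw [hz, dist_eq_norm, add_sub_cancel_left, norm_smul, ← dist_eq_norm, hd,
      Real.norm_of_nonneg h0]

/-- A normal segment ending at a point of the open tube can be prolonged. -/
theorem exists_extension [CompleteSpace E] (h : IsNearestPointMap ε W pr)
    (hpr : ContDiffOn ℝ 1 pr {z | infDist z W < ε}) {x : E} (hx : infDist x W < ε) :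
    ∃ y, infDist y W < ε ∧ ∃ μ : ℝ, 0 < μ ∧ μ < 1 ∧ x = pr y + μ • (y - pr y) := by
  have hopen : IsOpen {z | infDist z W < ε} :=
    isOpen_lt (continuous_infDist_pt W) continuous_const
  have hnhds : {z | infDist z W < ε} ∈ 𝓝 x := hopen.mem_nhds hx
  have hat : ContDiffAt ℝ 1 (fun y => y - pr y) x := contDiffAt_id.sub (hpr.contDiffAt hnhds)
  obtain ⟨K, s, hs, hK⟩ := hat.exists_lipschitzOnWith
  obtain ⟨ρ, hρ, hball⟩ := nhds_basis_closedBall.mem_iff.1 (Filter.inter_mem hs hnhds)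
  have hε : 0 < ε := infDist_nonneg.trans_lt hx
  obtain ⟨τ, hτ0, hτ1, hτρ, hτK⟩ : ∃ τ : ℝ, 0 < τ ∧ τ < 1 ∧ τ * ε ≤ ρ ∧ τ * K < 1 := by
    have hK0 : (0 : ℝ) ≤ K := K.2
    refine ⟨min (1 / 2) (min (ρ / ε) (1 / (K + 1))), by positivity, ?_, ?_, ?_⟩
    · exact (min_le_left _ _).trans_lt (by norm_num)
    · have : min (1 / 2) (min (ρ / ε) (1 / ((K : ℝ) + 1))) ≤ ρ / ε :=
        (min_le_right _ _).trans (min_le_left _ _)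
      exact (le_div_iff₀ hε).1 this
    · have : min (1 / 2) (min (ρ / ε) (1 / ((K : ℝ) + 1))) ≤ 1 / (K + 1) :=
        (min_le_right _ _).trans (min_le_right _ _)
      refine (mul_le_mul_of_nonneg_right this hK0).trans_lt ?_
      rw [div_mul_eq_mul_div, one_mul, div_lt_one (by positivity)]
      linarith
  set f : E → E := fun y => x + τ • (y - pr y) with hf
  have hmaps : MapsTo f (closedBall x ρ) (closedBall x ρ) := by
    intro y hy
    have hy' : infDist y W < ε := (hball hy).2
    rw [mem_closedBall, dist_eq_norm, hf, add_sub_cancel_left, norm_smul, ← dist_eq_norm,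
      (h y hy').2.1, Real.norm_of_nonneg hτ0.le]
    exact (mul_le_mul_of_nonneg_left hy'.le hτ0.le).trans hτρ
  have hlip : ContractingWith (⟨τ, hτ0.le⟩ * K) (hmaps.restrict f _ _) := by
    refine ⟨by exact_mod_cast hτK, LipschitzWith.of_dist_le_mul fun a b => ?_⟩
    have := hK.dist_le_mul a.1 (hball a.2).1 b.1 (hball b.2).1
    change dist (x + τ • (a.1 - pr a.1)) (x + τ • (b.1 - pr b.1)) ≤ (τ * K) * dist a.1 b.1
    rw [dist_add_left, dist_smul₀, Real.norm_of_nonneg hτ0.le, mul_assoc]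
    exact mul_le_mul_of_nonneg_left this hτ0.le
  obtain ⟨y, hy, hfix, -⟩ := hlip.exists_fixedPoint' isClosed_closedBall.isComplete hmaps
    (mem_closedBall_self hρ.le) (edist_ne_top _ _)
  refine ⟨y, (hball hy).2, 1 - τ, by linarith, by linarith, ?_⟩
  have hfix' : x + τ • (y - pr y) = y := hfix
  have : x = y - τ • (y - pr y) := eq_sub_of_add_eq hfix'
  rw [sub_smul, one_smul]
  nth_rewrite 1 [this]
  abel

/-- A unit segment that starts out realizing the distance to `W` does so up to length `ε`. -/
theorem infDist_add_smul [CompleteSpace E] (h : IsNearestPointMap ε W pr)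
    (hpr : ContDiffOn ℝ 1 pr {z | infDist z W < ε}) {w v : E} (hw : w ∈ W) (hv : ‖v‖ = 1)
    {t₀ : ℝ} (ht₀ : 0 < t₀) (hstart : infDist (w + t₀ • v) W = t₀) {t : ℝ} (ht : t₀ ≤ t)
    (htε : t < ε) : infDist (w + t • v) W = t := by
  set A : Set ℝ := {s | infDist (w + s • v) W = s} ∩ Icc t₀ t with hA
  have hAc : IsCompact A := by
    refine isCompact_Icc.inter_left (isClosed_eq ?_ continuous_id)
    exact (continuous_infDist_pt W).comp (by fun_prop)
  have hS := hAc.sSup_mem ⟨t₀, hstart, left_mem_Icc.2 ht⟩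
  set S := sSup A
  obtain ⟨hS1, hS2, hS3⟩ := hS
  rcases hS3.eq_or_lt with e | hlt
  · exact e ▸ hS1
  exfalso
  have hS0 : 0 < S := ht₀.trans_le hS2
  have hS1 : infDist (w + S • v) W = S := hS1
  have hSε : infDist (w + S • v) W < ε := by rw [hS1]; linarith
  obtain ⟨y, hy, μ, hμ0, hμ1, hxy⟩ := h.exists_extension hpr hSε
  have hprx : w = pr (w + S • v) := by
    refine (h _ hSε).2.2 w hw ?_
    rw [hS1, dist_eq_norm, add_sub_cancel_left, norm_smul, hv, mul_one, Real.norm_of_nonneg hS0.le]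
  have hpry : pr y = w := by
    rw [hprx, hxy, h.pr_segment hy hμ0.le hμ1.le]
  have hdy : infDist y W = S / μ := by
    have := h.infDist_segment hy hμ0.le hμ1.le
    rw [← hxy, hS1] at this
    rw [this]; field_simp
  have hyv : y - pr y = (S / μ) • v := by
    rw [hpry] at hxy ⊢
    have h3 : S • v = μ • (y - w) := add_left_cancel hxy
    rw [div_eq_inv_mul, mul_smul, h3, smul_smul, inv_mul_cancel₀ hμ0.ne', one_smul]
  have hSμ : S < S / μ := by rw [lt_div_iff₀ hμ0]; nlinarith
  set t' := min t (S / μ) with ht'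
  have ht'S : S < t' := lt_min hlt hSμ
  have hmem : t' ∈ A := by
    refine ⟨?_, hS2.trans ht'S.le, min_le_left _ _⟩
    have hSμ0 : 0 < S / μ := by positivity
    have h4 := h.infDist_segment hy (μ := t' / (S / μ))
      (div_nonneg (hS0.trans ht'S).le hSμ0.le)
      ((div_le_one hSμ0).2 (min_le_right _ _))
    rwa [hyv, hdy, smul_smul, div_mul_cancel₀ _ hSμ0.ne', hpry] at h4
  exact absurd (le_csSup hAc.bddAbove hmem) (not_le.2 ht'S)

end IsNearestPointMap

/-- If `W` is infinitesimally orthogonal to the unit vector `v` at `w`, then `w` is the nearest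
point of `W` on a short segment in the direction `v`. -/
theorem exists_infDist_add_smul_eq {E : Type*} [NormedAddCommGroup E] [InnerProductSpace ℂ E]
    {W : Set E} {w v : E} (hw : w ∈ W) (hv : ‖v‖ = 1) {K δ : ℝ} (hK : 0 ≤ K) (hδ : 0 < δ)
    (h : ∀ c ∈ W ∩ ball w δ, (inner ℂ v (c - w)).re ≤ K * ‖c - w‖ ^ 2) {η : ℝ} (hη : 0 < η) :
    ∃ t₀, 0 < t₀ ∧ t₀ < η ∧ infDist (w + (t₀ : ℂ) • v) W = t₀ := by
  obtain ⟨t, ht0, htη, htδ, htK⟩ : ∃ t : ℝ, 0 < t ∧ t < η ∧ 2 * t < δ ∧ 2 * t * K ≤ 1 := by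
    refine ⟨min (η / 2) (min (δ / 3) (1 / (2 * K + 1))), by positivity, ?_, ?_, ?_⟩
    · exact (min_le_left _ _).trans_lt (by linarith)
    · have : min (η / 2) (min (δ / 3) (1 / (2 * K + 1))) ≤ δ / 3 :=
        (min_le_right _ _).trans (min_le_left _ _)
      linarith
    · have : min (η / 2) (min (δ / 3) (1 / (2 * K + 1))) ≤ 1 / (2 * K + 1) :=
        (min_le_right _ _).trans (min_le_right _ _)
      rw [le_div_iff₀ (by positivity)] at this
      have h0 : 0 < min (η / 2) (min (δ / 3) (1 / (2 * K + 1))) := by positivity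
      linarith
  refine ⟨t, ht0, htη, ?_⟩
  have htv : ‖(t : ℂ) • v‖ = t := by
    rw [norm_smul, hv, mul_one, Complex.norm_real, Real.norm_of_nonneg ht0.le]
  refine le_antisymm ?_ ((le_infDist ⟨w, hw⟩).2 fun c hc => ?_)
  · refine (infDist_le_dist_of_mem hw).trans_eq ?_
    rw [dist_eq_norm, add_sub_cancel_left, htv]
  · have e : w + (t : ℂ) • v - c = (t : ℂ) • v - (c - w) := by abel
    rw [dist_eq_norm, e]
    by_cases hcδ : c ∈ ball w δ
    · have h1 := h c ⟨hc, hcδ⟩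
      have h2 := norm_sub_sq (𝕜 := ℂ) ((t : ℂ) • v) (c - w)
      rw [inner_smul_left, Complex.conj_ofReal, RCLike.re_to_complex, Complex.re_ofReal_mul,
        htv] at h2
      refine le_of_sq_le_sq ?_ (norm_nonneg _)
      rw [h2]
      nlinarith [mul_le_mul_of_nonneg_left h1 ht0.le, sq_nonneg ‖c - w‖]
    · have h1 : δ ≤ ‖c - w‖ := by simpa [dist_eq_norm] using hcδ
      have h2 := norm_sub_norm_le (c - w) ((t : ℂ) • v)
      rw [htv, norm_sub_rev (c - w)] at h2
      linarith

/-- A hypersurface with a tubular neighbourhood of radius `ε` separates from its complex tangent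
spaces at most quadratically. -/
theorem exists_unit_normal_s12 {n : ℕ} {T : En n → ℂ} (hT : Differentiable ℂ T) {ε : ℝ}
    {W : Set (En n)} (hWT : W = T ⁻¹' {0}) (hflat : UniformlyFlatWith ε W) {w : En n} (hw : w ∈ W)
    (hdT : fderiv ℂ T w ≠ 0) :
    ∃ ν : En n, ‖ν‖ = 1 ∧ ∀ c ∈ W, ε * ‖inner ℂ ν (c - w)‖ ≤ ‖c - w‖ ^ 2 := by
  obtain ⟨hε, pr, hpr, hnear⟩ := hflat
  have hnear : IsNearestPointMap ε W pr := hnear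
  set a : En n := (InnerProductSpace.toDual ℂ (En n)).symm (fderiv ℂ T w) with ha
  have ha0 : a ≠ 0 := by simpa [ha] using hdT
  have hna : 0 < ‖a‖ := norm_pos_iff.2 ha0
  have hin : ∀ u, inner ℂ a u = fderiv ℂ T w u := fun u =>
    InnerProductSpace.toDual_symm_apply
  obtain ⟨K, hK, δ, hδ, hKδ⟩ := exists_norm_sub_fderiv_le hT w
  set ν : En n := ((‖a‖⁻¹ : ℝ) : ℂ) • a with hν
  have hν1 : ‖ν‖ = 1 := by
    rw [hν, norm_smul, Complex.norm_real, norm_inv, norm_norm, inv_mul_cancel₀ hna.ne']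
  have hTw : T w = 0 := by simpa [hWT] using hw
  have hloc : ∀ c ∈ W ∩ ball w δ, ‖inner ℂ ν (c - w)‖ ≤ ‖a‖⁻¹ * K * ‖c - w‖ ^ 2 := by
    rintro c ⟨hc, hcδ⟩
    have hTc : T c = 0 := by simpa [hWT] using hc
    have := hKδ c hcδ
    rw [hTc, hTw, sub_zero, zero_sub, norm_neg] at this
    rw [hν, inner_smul_left, hin, norm_mul, Complex.conj_ofReal, Complex.norm_real, norm_inv,
      norm_norm, mul_assoc]
    gcongr
  have hglob : ∀ c ∈ W, ∀ l : ℂ, ‖l‖ = 1 →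
      ε * (inner ℂ (l • ν) (c - w)).re ≤ ‖c - w‖ ^ 2 := by
    intro c hc l hl
    have hlν : ‖l • ν‖ = 1 := by rw [norm_smul, hl, hν1, one_mul]
    obtain ⟨t₀, ht₀, ht₀ε, hst⟩ := exists_infDist_add_smul_eq hw hlν (K := ‖a‖⁻¹ * K)
      (by positivity) hδ (fun c hc => (Complex.re_le_norm _).trans <| by
        rw [inner_smul_left, norm_mul, RCLike.norm_conj, hl, one_mul]
        exact hloc c hc) (half_pos hε)
    have hd : infDist (w + (ε / 2) • l • ν) W = ε / 2 :=
      hnear.infDist_add_smul (hpr.of_le (by simp)) hw hlν ht₀ hst ht₀ε.le (half_lt_self hε)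
    have hle := infDist_le_dist_of_mem (x := w + (ε / 2) • l • ν) hc
    have e : w + (ε / 2) • l • ν - c = ((ε / 2 : ℝ) : ℂ) • l • ν - (c - w) := by
      rw [Complex.coe_smul]; abel
    rw [hd, dist_eq_norm, e] at hle
    have h2 := norm_sub_sq (𝕜 := ℂ) (((ε / 2 : ℝ) : ℂ) • l • ν) (c - w)
    rw [inner_smul_left, Complex.conj_ofReal, RCLike.re_to_complex, Complex.re_ofReal_mul,
      norm_smul, hlν, mul_one, Complex.norm_real, Real.norm_of_nonneg (half_pos hε).le] at h2
    have h3 := pow_le_pow_left₀ (half_pos hε).le hle 2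
    linarith
  refine ⟨ν, hν1, fun c hc => ?_⟩
  set s := inner ℂ ν (c - w) with hs
  rcases eq_or_ne s 0 with h0 | h0
  · rw [h0]; simp
  have hs0 : 0 < ‖s‖ := norm_pos_iff.2 h0
  have := hglob c hc (((‖s‖⁻¹ : ℝ) : ℂ) * s) (by
    rw [norm_mul, Complex.norm_real, norm_inv, norm_norm, inv_mul_cancel₀ hs0.ne'])
  rw [inner_smul_left, ← hs, map_mul, Complex.conj_ofReal, mul_assoc, Complex.conj_mul',
    ← Complex.ofReal_pow, ← Complex.ofReal_mul, Complex.ofReal_re] at this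
  convert this using 2
  field_simp

/-- A set which is transversal to the unit vector `m` is a Lipschitz graph over the complex
hyperplane orthogonal to `m`; this bounds its Hausdorff measures. -/
theorem hausdorffMeasure_le_of_transversal {H : Type*} [NormedAddCommGroup H]
    [InnerProductSpace ℂ H] [MeasurableSpace H] [BorelSpace H] {m : H} (hm : ‖m‖ = 1) {S : Set H}
    {z : H} {r : ℝ} (hSr : S ⊆ ball z r)
    (hS : ∀ x ∈ S, ∀ y ∈ S, ‖inner ℂ m (x - y)‖ ≤ ‖x - y‖ / 2) {d : ℝ} (hd : 0 ≤ d) :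
    μH[d] S ≤ (2 : ℝ≥0∞) ^ d * μH[d] (ball (0 : (ℂ ∙ m)ᗮ) r) := by
  set P : H →L[ℂ] (ℂ ∙ m)ᗮ := (ℂ ∙ m)ᗮ.orthogonalProjectionOnto with hP
  have hPle : ∀ x, ‖P x‖ ≤ ‖x‖ := fun x => Submodule.norm_orthogonalProjectionOnto_apply_le _ x
  have hanti : ∀ x ∈ S, ∀ y ∈ S, dist x y ≤ 2 * dist (P x) (P y) := by
    intro x hx y hy
    have h1 : (ℂ ∙ m).starProjection (x - y) + ((P (x - y) : (ℂ ∙ m)ᗮ) : H) = x - y :=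
      Submodule.starProjection_add_starProjection_orthogonal (K := ℂ ∙ m) (x - y)
    rw [Submodule.starProjection_unit_singleton ℂ hm] at h1
    have h2 : ‖x - y‖ ≤ ‖x - y‖ / 2 + ‖P (x - y)‖ := by
      calc ‖x - y‖ ≤ ‖inner ℂ m (x - y) • m‖ + ‖((P (x - y) : (ℂ ∙ m)ᗮ) : H)‖ := by
            nth_rewrite 1 [← h1]; exact norm_add_le _ _
        _ ≤ _ := by
            rw [norm_smul, hm, mul_one, Submodule.norm_coe]
            gcongr
            exact hS x hx y hy
    rw [dist_eq_norm, dist_eq_norm, ← map_sub]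
    linarith
  have hinj : InjOn P S := fun x hx y hy hxy => by
    have := hanti x hx y hy
    rw [hxy, dist_self, mul_zero] at this
    exact dist_le_zero.1 this
  have hinv : LipschitzOnWith 2 (Function.invFunOn P S) (P '' S) := by
    refine LipschitzOnWith.of_dist_le_mul ?_
    rintro _ ⟨x, hx, rfl⟩ _ ⟨y, hy, rfl⟩
    rw [hinj.leftInvOn_invFunOn hx, hinj.leftInvOn_invFunOn hy]
    exact hanti x hx y hy
  have himg : Function.invFunOn P S '' (P '' S) = S := hinj.invFunOn_image subset_rfl
  have hsub : P '' S ⊆ IsometryEquiv.addRight (P z) '' ball 0 r := by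
    rintro _ ⟨x, hx, rfl⟩
    refine ⟨P (x - z), ?_, by simp⟩
    rw [mem_ball_zero_iff]
    exact (hPle _).trans_lt (mem_ball_iff_norm.1 (hSr hx))
  calc μH[d] S = μH[d] (Function.invFunOn P S '' (P '' S)) := by rw [himg]
    _ ≤ (2 : ℝ≥0∞) ^ d * μH[d] (P '' S) := by
        simpa using hinv.hausdorffMeasure_image_le hd
    _ ≤ (2 : ℝ≥0∞) ^ d * μH[d] (ball (0 : (ℂ ∙ m)ᗮ) r) := by
        refine mul_le_mul_right ?_ _
        exact (measure_mono hsub).trans_eq (IsometryEquiv.hausdorffMeasure_image _ _ _)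

theorem hausdorffMeasure_ball_orthogonal_lt_top {n : ℕ} (hn : n ≠ 0) {m : En n} (hm : ‖m‖ = 1)
    (r : ℝ) : μH[(2 * n - 2 : ℝ)] (ball (0 : (ℂ ∙ m)ᗮ) r) < ⊤ := by
  obtain ⟨k, rfl⟩ := Nat.exists_eq_succ_of_ne_zero hn
  have : Fact (Module.finrank ℂ (En (k + 1)) = k + 1) := ⟨finrank_euclideanSpace_fin⟩
  have hm0 : m ≠ 0 := norm_ne_zero_iff.1 (by simp [hm])
  have e : Module.finrank ℝ (ℂ ∙ m)ᗮ = 2 * k := by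
    rw [finrank_real_of_complex, Submodule.finrank_orthogonal_span_singleton (n := k) hm0]
  have h := isAddHaarMeasure_hausdorffMeasure (E := (ℂ ∙ m)ᗮ)
  rw [e] at h
  have e2 : (2 * ((k.succ : ℕ) : ℝ) - 2) = ((2 * k : ℕ) : ℝ) := by push_cast; ring
  rw [e2]
  exact measure_ball_lt_top

/-- A uniformly flat hypersurface has uniformly bounded area in balls of a fixed radius. -/
theorem exists_hausdorffMeasure_inter_ball_le {n : ℕ} (hn : n ≠ 0) {ε : ℝ} (hε : 0 < ε)
    {W : Set (En n)}
    (hnormal : ∀ w ∈ W, ∃ ν : En n, ‖ν‖ = 1 ∧ ∀ c ∈ W, ε * ‖inner ℂ ν (c - w)‖ ≤ ‖c - w‖ ^ 2) :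
    ∃ C : ℝ≥0∞, C ≠ ⊤ ∧ ∀ z, μH[(2 * n - 2 : ℝ)] (W ∩ ball z (ε / 16)) ≤ C := by
  choose! ν hν1 hν using hnormal
  have hd : (0 : ℝ) ≤ 2 * n - 2 := by
    have : (1 : ℝ) ≤ n := by exact_mod_cast Nat.one_le_iff_ne_zero.2 hn
    linarith
  obtain ⟨t, hts, htf, hcov⟩ := (isCompact_sphere (0 : En n) 1).finite_cover_balls
    (e := 1 / 8) (by norm_num)
  have htn : ∀ m ∈ t, ‖m‖ = 1 := fun m hm => mem_sphere_zero_iff_norm.1 (hts hm)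
  set C : En n → ℝ≥0∞ := fun m =>
    (2 : ℝ≥0∞) ^ (2 * n - 2 : ℝ) * μH[(2 * n - 2 : ℝ)] (ball (0 : (ℂ ∙ m)ᗮ) (ε / 16))
  refine ⟨∑ m ∈ htf.toFinset, C m, ?_, fun z => ?_⟩
  · refine (ENNReal.sum_lt_top.2 fun m hm => ENNReal.mul_lt_top ?_ ?_).ne
    · exact (ENNReal.rpow_ne_top_of_nonneg hd ENNReal.ofNat_ne_top).lt_top
    · exact hausdorffMeasure_ball_orthogonal_lt_top hn (htn m (htf.mem_toFinset.1 hm)) _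
  set S : En n → Set (En n) := fun m => {w ∈ W ∩ ball z (ε / 16) | ‖ν w - m‖ < 1 / 8} with hS
  have hsub : W ∩ ball z (ε / 16) ⊆ ⋃ m ∈ htf.toFinset, S m := by
    intro w hw
    obtain ⟨m, hm, hwm⟩ := mem_iUnion₂.1 (hcov (mem_sphere_zero_iff_norm.2 (hν1 w hw.1)))
    exact mem_iUnion₂.2 ⟨m, htf.mem_toFinset.2 hm, hw, mem_ball_iff_norm.1 hwm⟩
  refine (measure_mono hsub).trans ((measure_biUnion_finset_le _ _).trans
    (Finset.sum_le_sum fun m hm => ?_))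
  refine hausdorffMeasure_le_of_transversal (htn m (htf.mem_toFinset.1 hm)) (z := z)
    (fun w hw => hw.1.2) (fun x hx y hy => ?_) hd
  have hxy : ‖x - y‖ ≤ ε / 8 := by
    have h1 := dist_triangle_right x y z
    have h2 := mem_ball.1 hx.1.2
    have h3 := mem_ball.1 hy.1.2
    rw [← dist_eq_norm]
    linarith
  have h1 : ‖inner ℂ (ν y) (x - y)‖ ≤ ‖x - y‖ / 8 := by
    have := hν y hy.1.1 x hx.1.1
    have h0 := norm_nonneg (x - y)
    nlinarith
  have h2 : ‖inner ℂ (ν y - m) (x - y)‖ ≤ 1 / 8 * ‖x - y‖ :=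
    (norm_inner_le_norm _ _).trans (mul_le_mul_of_nonneg_right hy.2.le (norm_nonneg _))
  have h3 : inner ℂ m (x - y) = inner ℂ (ν y) (x - y) - inner ℂ (ν y - m) (x - y) := by
    rw [inner_sub_left, sub_sub_cancel]
  rw [h3]
  have h4 := norm_sub_le (inner ℂ (ν y) (x - y)) (inner ℂ (ν y - m) (x - y))
  have h0 := norm_nonneg (x - y)
  linarith

/-- Integrating a mean value inequality over balls against a measure whose balls of the same
radius have bounded mass. -/
theorem lintegral_mul_le_of_le_setLIntegral_ball {E : Type*} [PseudoMetricSpace E]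
    [SecondCountableTopology E] [MeasurableSpace E] [OpensMeasurableSpace E] {μ σ : Measure E}
    [SFinite μ] [SFinite σ] {G : E → ℝ≥0∞} (hG : Measurable G) {r : ℝ} {c C : ℝ≥0∞}
    (hμ : ∀ w, G w * c ≤ ∫⁻ z in ball w r, G z ∂μ) (hσ : ∀ z, σ (ball z r) ≤ C) :
    (∫⁻ w, G w ∂σ) * c ≤ C * ∫⁻ z, G z ∂μ := by
  have hset : MeasurableSet {q : E × E | dist q.2 q.1 < r} :=
    measurableSet_lt (measurable_snd.dist measurable_fst) measurable_const
  have hmeas : Measurable (Function.uncurry fun w z => (ball w r).indicator G z) :=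
    (hG.comp measurable_snd).indicator hset
  calc (∫⁻ w, G w ∂σ) * c = ∫⁻ w, G w * c ∂σ := (lintegral_mul_const c hG).symm
    _ ≤ ∫⁻ w, (∫⁻ z, (ball w r).indicator G z ∂μ) ∂σ := lintegral_mono fun w => by
        rw [lintegral_indicator measurableSet_ball]
        exact hμ w
    _ = ∫⁻ z, (∫⁻ w, (ball w r).indicator G z ∂σ) ∂μ :=
        lintegral_lintegral_swap hmeas.aemeasurable
    _ = ∫⁻ z, G z * σ (ball z r) ∂μ := by
        refine lintegral_congr fun z => ?_
        have e : (fun w => (ball w r).indicator G z) = (ball z r).indicator fun _ => G z := by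
          ext w
          simp only [indicator, mem_ball, dist_comm]
        rw [e, lintegral_indicator_const measurableSet_ball]
    _ ≤ ∫⁻ z, C * G z ∂μ := lintegral_mono fun z => by
        rw [mul_comm]
        exact mul_le_mul_left (hσ z) _
    _ = C * ∫⁻ z, G z ∂μ := lintegral_const_mul C hG

/-- **Corollary (upper sampling inequality).**  Let `W = T⁻¹(0)` be uniformly flat,
`1 ≤ p < ∞`, and let `φ` be `C²` plurisubharmonic with `i∂∂̄φ ≤ Mω`.  Then there is
`M' > 1` such that `∫_W |F|^p e^{-pφ} dσ ≤ M' ∫_{ℂⁿ} |F|^p e^{-pφ} dV` for every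
`F ∈ BF^p_φ(ℂⁿ)`. -/
theorem upper_sampling_inequality
    (n : ℕ) (p : ℝ) (hp : 1 ≤ p) (M : ℝ) (hM : 0 < M)
    (T : En n → ℂ) (hT : Differentiable ℂ T)
    (W : Set (En n)) (hWT : W = T ⁻¹' {0})
    (hdT : ∀ z ∈ W, fderiv ℂ T z ≠ 0)
    (hflat : UniformlyFlat W)
    (φ : En n → ℝ) (hφ : ContDiff ℝ 2 φ)
    (hpsh : ∀ z v : En n, 0 ≤ levi φ z v)
    (hbd : ∀ z v : En n, levi φ z v ≤ M * ‖v‖ ^ 2) :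
    ∃ M' > (1 : ℝ), ∀ F : En n → ℂ, Differentiable ℂ F →
      (∫⁻ z, ENNReal.ofReal (‖F z‖ ^ p * Real.exp (-(p * φ z))) ∂(vol n) < ⊤) →
      ∫⁻ z in W, ENNReal.ofReal (‖F z‖ ^ p * Real.exp (-(p * φ z))) ∂(surf n W) ≤
        ENNReal.ofReal M' *
          ∫⁻ z, ENNReal.ofReal (‖F z‖ ^ p * Real.exp (-(p * φ z))) ∂(vol n) := by
  obtain ⟨ε, hflat⟩ := hflat
  have hε : 0 < ε := hflat.1
  have hn : n ≠ 0 := by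
    rintro rfl
    obtain ⟨w, hw⟩ : W.Nonempty := by
      by_contra h
      obtain ⟨pr, -, hpr⟩ := hflat.2
      rw [not_nonempty_iff_eq_empty.1 h] at hpr
      exact (hpr 0 (by simpa using hε)).1
    exact hdT w hw (Subsingleton.elim _ _)
  obtain ⟨C, hC, hCball⟩ := exists_hausdorffMeasure_inter_ball_le hn hε fun w hw =>
    exists_unit_normal_s12 hT hWT hflat hw (hdT w hw)
  have hr : 0 < ε / 16 := by positivity
  have := isAddHaarMeasure_vol_s12 n
  have hσ : ∀ z, (μH[(2 * n - 2 : ℝ)] : Measure (En n)).restrict W (ball z (ε / 16)) ≤ C :=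
    fun z => by
      rw [Measure.restrict_apply measurableSet_ball, inter_comm]
      exact hCball z
  have : IsLocallyFiniteMeasure ((μH[(2 * n - 2 : ℝ)] : Measure (En n)).restrict W) :=
    ⟨fun z => ⟨ball z (ε / 16), ball_mem_nhds z hr, (hσ z).trans_lt hC.lt_top⟩⟩
  set c : ℝ≥0∞ := ENNReal.ofReal (Real.exp (-(p * (M * (ε / 16) ^ 2)))) *
    vol n (ball 0 (ε / 16)) with hc
  have hc0 : c ≠ 0 := mul_ne_zero (by simpa using Real.exp_pos _) (measure_ball_pos _ _ hr).ne'
  have hct : c ≠ ⊤ := ENNReal.mul_ne_top ENNReal.ofReal_ne_top measure_ball_lt_top.ne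
  set k : ℝ≥0∞ := (2 : ℝ≥0∞) ^ (n - 1) * (Nat.factorial (n - 1) : ℝ≥0∞) with hk
  have hkt : k ≠ ⊤ :=
    ENNReal.mul_ne_top (ENNReal.pow_ne_top ENNReal.ofNat_ne_top) (ENNReal.natCast_ne_top _)
  have hA : k * (C / c) ≠ ⊤ := ENNReal.mul_ne_top hkt (ENNReal.div_ne_top hC hc0)
  refine ⟨(k * (C / c)).toReal + 2, by linarith [ENNReal.toReal_nonneg (a := k * (C / c))],
    fun F hF _ => ?_⟩
  have hp0 : 0 < p := by linarith
  set G : En n → ℝ≥0∞ := fun z => ENNReal.ofReal (‖F z‖ ^ p * Real.exp (-(p * φ z))) with hGdef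
  have hG : Measurable G := by
    have h1 := hF.continuous
    have h2 := hφ.continuous
    have : Continuous fun z => ‖F z‖ ^ p * Real.exp (-(p * φ z)) :=
      (h1.norm.rpow_const fun _ => Or.inr hp0.le).mul (by fun_prop)
    exact this.measurable.ennreal_ofReal
  have hmain : (∫⁻ w, G w ∂(μH[(2 * n - 2 : ℝ)] : Measure (En n)).restrict W) ≤
      C / c * ∫⁻ z, G z ∂(vol n) := by
    have h := lintegral_mul_le_of_le_setLIntegral_ball hG
      (fun w => weighted_mul_vol_ball_le hp0 hM.le hφ hbd hF w (ε / 16)) hσ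
    rw [ENNReal.div_eq_inv_mul, mul_assoc, ← ENNReal.div_eq_inv_mul]
    exact (ENNReal.le_div_iff_mul_le (Or.inl hc0) (Or.inl hct)).2 h
  calc ∫⁻ z in W, G z ∂(surf n W) ≤ ∫⁻ z, G z ∂(surf n W) :=
        lintegral_mono' Measure.restrict_le_self le_rfl
    _ = k * ∫⁻ z, G z ∂(μH[(2 * n - 2 : ℝ)] : Measure (En n)).restrict W := by
        rw [surf, lintegral_smul_measure, smul_eq_mul]
    _ ≤ k * (C / c * ∫⁻ z, G z ∂(vol n)) := mul_le_mul_right hmain _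
    _ = k * (C / c) * ∫⁻ z, G z ∂(vol n) := (mul_assoc _ _ _).symm
    _ ≤ ENNReal.ofReal ((k * (C / c)).toReal + 2) * ∫⁻ z, G z ∂(vol n) := by
        refine mul_le_mul_left ?_ _
        rw [← ENNReal.ofReal_toReal hA, ENNReal.toReal_ofReal ENNReal.toReal_nonneg]
        exact ENNReal.ofReal_le_ofReal (by linarith)
end
end

section
/- Let φ : ℂ → ℝ be a C² function, let K ≥ 0, and let f be an entire function with f(0) = 1 and log|f(z)| ≤ φ(z) + K for all z ∈ ℂ. Then for every R > 0, ∫₀^R n(0,s)/s ds ≤ φ(0) + K + (1/2π) ∫₀^R s^{-1} (∫_{D(0,s)} Δφ dA) ds, where n(0,s) denotes the number of zeros of f, counted with multiplicity, in the closed disk {|z| ≤ s}. -/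
open MeasureTheory Metric Set
open scoped ENNReal Topology

noncomputable section

/-- The Laplacian `Δφ = φ_{xx} + φ_{yy}` of a function `φ : ℂ → ℝ`. -/
def lap (φ : ℂ → ℝ) (z : ℂ) : ℝ :=
  fderiv ℝ (fderiv ℝ φ) z 1 1 + fderiv ℝ (fderiv ℝ φ) z Complex.I Complex.I

/-- The vanishing order of `f` at `z`: the least `k` with `f^{(k)}(z) ≠ 0`
(`0` if `f(z) ≠ 0`, junk value `0` if `f` vanishes to infinite order). -/
def ordAt (f : ℂ → ℂ) (z : ℂ) : ℕ := sInf {k : ℕ | iteratedDeriv k f z ≠ 0}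

/-- `n(0,s)`: the number of zeros of `f`, counted with multiplicity, in the closed disk
of radius `s` about the origin. -/
def nZeros (f : ℂ → ℂ) (s : ℝ) : ℕ := ∑ᶠ z ∈ Metric.closedBall (0 : ℂ) s, ordAt f z

section Jensen

lemma ordAt_eq_analyticOrderNatAt {f : ℂ → ℂ} {z : ℂ} (hf : AnalyticAt ℂ f z) :
    ordAt f z = analyticOrderNatAt f z := by
  unfold ordAt analyticOrderNatAt
  cases h : analyticOrderAt f z with
  | top =>
    have : {k : ℕ | iteratedDeriv k f z ≠ 0} = ∅ := by
      ext k
      have hk : ((k + 1 : ℕ) : ℕ∞) ≤ analyticOrderAt f z := by simp [h]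
      simpa using (natCast_le_analyticOrderAt_iff_iteratedDeriv_eq_zero hf).1 hk k (by omega)
    simp [this]
  | coe n =>
    obtain ⟨h₁, h₂⟩ := (analyticOrderAt_eq_nat_iff_iteratedDeriv_eq_zero hf).1 h
    refine le_antisymm (Nat.sInf_le h₂) (le_csInf ⟨n, h₂⟩ fun k hk => ?_)
    by_contra hlt
    exact hk (h₁ k (by simpa using hlt))

lemma divisor_eq_ordAt {f : ℂ → ℂ} {U : Set ℂ} (hf : AnalyticOnNhd ℂ f U) {z : ℂ} (hz : z ∈ U) :
    MeromorphicOn.divisor f U z = (ordAt f z : ℤ) := by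
  rw [MeromorphicOn.AnalyticOnNhd.divisor_apply hf hz, ordAt_eq_analyticOrderNatAt (hf z hz),
    analyticOrderNatAt]
  cases analyticOrderAt f z with
  | top => simp
  | coe n => rfl

lemma indicator_Ioc_indicator_Ici_inv {a R : ℝ} (ha : 0 < a) :
    Set.indicator (Ioc 0 R) ((Ici a).indicator fun s : ℝ => s⁻¹) =
      (Icc a R).indicator fun s : ℝ => s⁻¹ := by
  rw [Set.indicator_indicator]
  congr 1
  ext s
  simp only [mem_inter_iff, mem_Ioc, mem_Ici, mem_Icc]
  grind

lemma intervalIntegrable_indicator_Ici_inv {a R : ℝ} (ha : 0 < a) (hR : 0 < R) :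
    IntervalIntegrable ((Ici a).indicator fun s : ℝ => s⁻¹) volume 0 R := by
  rw [intervalIntegrable_iff_integrableOn_Ioc_of_le hR.le,
    ← integrable_indicator_iff measurableSet_Ioc, indicator_Ioc_indicator_Ici_inv ha,
    integrable_indicator_iff measurableSet_Icc]
  refine ContinuousOn.integrableOn_Icc fun s hs => ?_
  exact (continuousAt_inv₀ (ha.trans_le hs.1).ne').continuousWithinAt

lemma integral_indicator_Ici_inv {a R : ℝ} (ha : 0 < a) (haR : a ≤ R) :
    ∫ s in (0 : ℝ)..R, (Ici a).indicator (fun s : ℝ => s⁻¹) s = Real.log (R / a) := by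
  rw [intervalIntegral.integral_of_le (ha.le.trans haR), ← integral_indicator measurableSet_Ioc,
    indicator_Ioc_indicator_Ici_inv ha, integral_indicator measurableSet_Icc,
    integral_Icc_eq_integral_Ioc,
    ← intervalIntegral.integral_of_le haR, integral_inv_of_pos ha (ha.trans_le haR)]

/-- **Jensen's formula** for an entire function with `f 0 = 1`, in integrated form. -/
theorem integral_nZeros_div {f : ℂ → ℂ} (hf : Differentiable ℂ f) (hf0 : f 0 = 1) {R : ℝ}
    (hR : 0 < R) :
    ∫ s in (0 : ℝ)..R, (nZeros f s : ℝ) / s = Real.circleAverage (Real.log ‖f ·‖) 0 R := by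
  have han : AnalyticOnNhd ℂ f (closedBall 0 |R|) := fun z _ => hf.analyticAt z
  have hordAt : ordAt f 0 = 0 := Nat.sInf_eq_zero.2 (Or.inl (by simp [hf0]))
  set D := MeromorphicOn.divisor f (closedBall 0 |R|) with hD
  have hfin := D.finiteSupport (isCompact_closedBall 0 |R|)
  have hDin {u : ℂ} (hu : ‖u‖ ≤ R) : D u = (ordAt f u : ℤ) :=
    divisor_eq_ordAt han (by simpa [abs_of_pos hR] using hu)
  have hZ (u : ℂ) : u ∈ hfin.toFinset ↔ ‖u‖ ≤ R ∧ ordAt f u ≠ 0 := by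
    rw [Set.Finite.mem_toFinset, Function.mem_support]
    constructor
    · intro h
      have hu : ‖u‖ ≤ R := by
        simpa [abs_of_pos hR] using D.supportWithinDomain (Function.mem_support.2 h)
      exact ⟨hu, by simpa [hDin hu] using h⟩
    · rintro ⟨hu, h⟩
      simpa [hDin hu] using h
  have hpos {u : ℂ} (hu : u ∈ hfin.toFinset) : 0 < ‖u‖ := by
    refine norm_pos_iff.2 fun h0 => ((hZ u).1 hu).2 (by rw [h0, hordAt])
  have hn {s : ℝ} (hs : s ≤ R) : (nZeros f s : ℝ) / s =
      ∑ u ∈ hfin.toFinset, (ordAt f u : ℝ) * (Ici ‖u‖).indicator (fun s : ℝ => s⁻¹) s := by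
    have : nZeros f s = ∑ u ∈ hfin.toFinset, (closedBall 0 s).indicator (ordAt f) u := by
      rw [nZeros, finsum_mem_def, finsum_eq_sum_of_support_subset]
      intro u hu
      rw [Set.support_indicator] at hu
      exact (hZ u).2 ⟨(mem_closedBall_zero_iff.1 hu.1).trans hs, hu.2⟩
    rw [this, Nat.cast_sum, Finset.sum_div]
    refine Finset.sum_congr rfl fun u _ => ?_
    by_cases h : ‖u‖ ≤ s <;> simp [h, div_eq_mul_inv]
  rw [AnalyticOnNhd.circleAverage_log_norm hR.ne' han (by simp [hf0]), hf0, norm_one,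
    Real.log_one, add_zero]
  calc ∫ s in (0 : ℝ)..R, (nZeros f s : ℝ) / s
      = ∫ s in (0 : ℝ)..R, ∑ u ∈ hfin.toFinset,
          (ordAt f u : ℝ) * (Ici ‖u‖).indicator (fun s : ℝ => s⁻¹) s := by
        refine intervalIntegral.integral_congr fun s hs => hn ?_
        rw [uIcc_of_le hR.le] at hs
        exact hs.2
    _ = ∑ u ∈ hfin.toFinset, (ordAt f u : ℝ) * Real.log (R / ‖u‖) := by
        rw [intervalIntegral.integral_finsetSum fun u hu =>
          (intervalIntegrable_indicator_Ici_inv (hpos hu) hR).const_mul _]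
        refine Finset.sum_congr rfl fun u hu => ?_
        rw [intervalIntegral.integral_const_mul,
          integral_indicator_Ici_inv (hpos hu) ((hZ u).1 hu).1]
    _ = ∑ᶠ u, (D u : ℝ) * Real.log (R * ‖0 - u‖⁻¹) := by
        rw [finsum_eq_sum_of_support_subset (s := hfin.toFinset)]
        · refine Finset.sum_congr rfl fun u hu => ?_
          rw [hDin ((hZ u).1 hu).1, zero_sub, norm_neg, div_eq_mul_inv, Int.cast_natCast]
        · intro u hu
          simp only [Finite.coe_toFinset, Function.mem_support]
          intro h
          simp [h] at hu

end Jensen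

section Green

lemma fderiv_fderiv_rotation (D : ℂ →L[ℝ] ℂ →L[ℝ] ℝ) {w : ℂ} (hw : ‖w‖ = 1) :
    D w w + D (w * Complex.I) (w * Complex.I) = D 1 1 + D Complex.I Complex.I := by
  have h₁ : w = w.re • (1 : ℂ) + w.im • Complex.I := by
    simp [Complex.re_add_im]
  have h₂ : w * Complex.I = (-w.im) • (1 : ℂ) + w.re • Complex.I := by
    apply Complex.ext <;> simp
  have hsq : w.re * w.re + w.im * w.im = 1 := by
    rw [← Complex.normSq_apply, Complex.normSq_eq_norm_sq, hw, one_pow]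
  rw [h₂]
  nth_rewrite 1 2 [h₁]
  simp only [map_add, map_smul, add_apply, smul_apply,
    smul_eq_mul]
  linear_combination (D 1 1 + D Complex.I Complex.I) * hsq

lemma continuous_fderiv_fderiv {φ : ℂ → ℝ} (hφ : ContDiff ℝ 2 φ) :
    Continuous (fderiv ℝ (fderiv ℝ φ)) :=
  (hφ.fderiv_right (m := 1) (by norm_num)).continuous_fderiv (by norm_num)

lemma continuous_lap {φ : ℂ → ℝ} (hφ : ContDiff ℝ 2 φ) : Continuous (lap φ) := by
  have := continuous_fderiv_fderiv hφ
  unfold lap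
  fun_prop

lemma hasDerivAt_circleMap_radius (s θ : ℝ) :
    HasDerivAt (fun s : ℝ => circleMap 0 s θ) (circleMap 0 1 θ) s := by
  simpa [circleMap] using (Complex.ofRealCLM.hasDerivAt (x := s)).mul_const
    (Complex.exp (θ * Complex.I))

lemma hasDerivAt_radial {φ : ℂ → ℝ} (hφ : ContDiff ℝ 2 φ) (s θ : ℝ) :
    HasDerivAt (fun s : ℝ => φ (circleMap 0 s θ))
      (fderiv ℝ φ (circleMap 0 s θ) (circleMap 0 1 θ)) s :=
  ((hφ.differentiable (by norm_num)) _).hasFDerivAt.comp_hasDerivAt s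
    (hasDerivAt_circleMap_radius s θ)

lemma hasDerivAt_mul_radial {φ : ℂ → ℝ} (hφ : ContDiff ℝ 2 φ) (s θ : ℝ) :
    HasDerivAt (fun s : ℝ => s * fderiv ℝ φ (circleMap 0 s θ) (circleMap 0 1 θ))
      (fderiv ℝ φ (circleMap 0 s θ) (circleMap 0 1 θ) +
        s * fderiv ℝ (fderiv ℝ φ) (circleMap 0 s θ) (circleMap 0 1 θ) (circleMap 0 1 θ)) s := by
  have h := (((hφ.fderiv_right (m := 1) (by norm_num)).differentiable
    (by norm_num)) (circleMap 0 s θ)).hasFDerivAt.comp_hasDerivAt s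
    (hasDerivAt_circleMap_radius s θ)
  simpa using (hasDerivAt_id' s).fun_mul (h.clm_apply (hasDerivAt_const s (circleMap 0 1 θ)))

lemma hasDerivAt_angular {φ : ℂ → ℝ} (hφ : ContDiff ℝ 2 φ) (s θ : ℝ) :
    HasDerivAt (fun θ : ℝ => fderiv ℝ φ (circleMap 0 s θ) (circleMap 0 1 θ * Complex.I))
      (s * lap φ (circleMap 0 s θ) - (fderiv ℝ φ (circleMap 0 s θ) (circleMap 0 1 θ) +
        s * fderiv ℝ (fderiv ℝ φ) (circleMap 0 s θ) (circleMap 0 1 θ) (circleMap 0 1 θ))) θ := by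
  have h := (((hφ.fderiv_right (m := 1) (by norm_num)).differentiable
    (by norm_num)) (circleMap 0 s θ)).hasFDerivAt.comp_hasDerivAt θ
    (hasDerivAt_circleMap 0 s θ)
  have hE := (hasDerivAt_circleMap 0 1 θ).mul_const Complex.I
  refine (h.clm_apply hE).congr_deriv ?_
  have h₁ : circleMap 0 s θ * Complex.I = s • (circleMap 0 1 θ * Complex.I) := by
    simp [circleMap, mul_assoc]
  have h₂ : circleMap 0 1 θ * Complex.I * Complex.I = -circleMap 0 1 θ := by
    rw [mul_assoc, Complex.I_mul_I, mul_neg_one]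
  have h₃ := fderiv_fderiv_rotation (fderiv ℝ (fderiv ℝ φ) (circleMap 0 s θ))
    (w := circleMap 0 1 θ) (by simp)
  rw [h₁, h₂, map_smul, map_neg, smul_apply, smul_eq_mul, lap, ← h₃]
  simp only [Function.comp_apply]
  ring

lemma integral_angular_eq {φ : ℂ → ℝ} (hφ : ContDiff ℝ 2 φ) (s : ℝ) :
    ∫ θ in (-Real.pi)..Real.pi, (fderiv ℝ φ (circleMap 0 s θ) (circleMap 0 1 θ) +
        s * fderiv ℝ (fderiv ℝ φ) (circleMap 0 s θ) (circleMap 0 1 θ) (circleMap 0 1 θ)) =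
      ∫ θ in (-Real.pi)..Real.pi, s * lap φ (circleMap 0 s θ) := by
  have hc₁ := continuous_lap hφ
  have hc₂ := continuous_fderiv_fderiv hφ
  have hc₃ := hφ.continuous_fderiv (by norm_num)
  have key := intervalIntegral.integral_eq_sub_of_hasDerivAt (a := -Real.pi) (b := Real.pi)
    (fun θ _ => hasDerivAt_angular hφ s θ)
    (Continuous.intervalIntegrable (by fun_prop) _ _)
  rw [intervalIntegral.integral_sub (Continuous.intervalIntegrable (by fun_prop) _ _)
    (Continuous.intervalIntegrable (by fun_prop) _ _)] at key
  have hper (r : ℝ) : circleMap 0 r (-Real.pi) = circleMap 0 r Real.pi := by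
    rw [← periodic_circleMap 0 r (-Real.pi)]
    congr 1
    ring
  rw [hper, hper, sub_self] at key
  linarith

lemma intervalIntegral_swap_of_continuous {F : ℝ → ℝ → ℝ} (hF : Continuous F.uncurry)
    (a b c d : ℝ) :
    ∫ x in a..b, ∫ y in c..d, F x y = ∫ y in c..d, ∫ x in a..b, F x y :=
  intervalIntegral_intervalIntegral_swap <|
    (hF.continuousOn.integrableOn_compact (isCompact_uIcc.prod isCompact_uIcc)).mono_set
      (prod_mono uIoc_subset_uIcc uIoc_subset_uIcc)

/-- Green's formula on a disk, in polar coordinates. -/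
lemma mul_integral_radial {φ : ℂ → ℝ} (hφ : ContDiff ℝ 2 φ) (r : ℝ) :
    r * ∫ θ in (-Real.pi)..Real.pi, fderiv ℝ φ (circleMap 0 r θ) (circleMap 0 1 θ) =
      ∫ s in (0 : ℝ)..r, ∫ θ in (-Real.pi)..Real.pi, s * lap φ (circleMap 0 s θ) := by
  have hc₂ := continuous_fderiv_fderiv hφ
  have hc₃ := hφ.continuous_fderiv (by norm_num)
  simp_rw [← integral_angular_eq hφ]
  rw [intervalIntegral_swap_of_continuous (by unfold Function.uncurry; fun_prop),
    ← intervalIntegral.integral_const_mul]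
  refine intervalIntegral.integral_congr fun θ _ => ?_
  rw [intervalIntegral.integral_eq_sub_of_hasDerivAt
    (fun s _ => hasDerivAt_mul_radial hφ s θ)
    (Continuous.intervalIntegrable (by fun_prop) _ _), zero_mul, sub_zero]

lemma integral_ball_eq_polar {F : ℂ → ℝ} (hF : Continuous F) {r : ℝ} (hr : 0 ≤ r) :
    ∫ z in ball (0 : ℂ) r, F z =
      ∫ s in (0 : ℝ)..r, ∫ θ in (-Real.pi)..Real.pi, s * F (circleMap 0 s θ) := by
  have hsymm (p : ℝ × ℝ) : Complex.polarCoord.symm p = circleMap 0 p.1 p.2 := by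
    simp [circleMap, Complex.exp_mul_I]
  have hind : polarCoord.target.indicator
        (fun p => p.1 • (ball (0 : ℂ) r).indicator F (Complex.polarCoord.symm p)) =
      (Ioo 0 r ×ˢ Ioo (-Real.pi) Real.pi).indicator (fun p => p.1 * F (circleMap 0 p.1 p.2)) := by
    classical
    ext ⟨s, θ⟩
    simp only [hsymm, Set.indicator_apply, polarCoord_target, mem_prod, mem_Ioi, mem_Ioo,
      mem_ball_zero_iff, norm_circleMap_zero, smul_eq_mul]
    by_cases hs : 0 < s
    · by_cases hθ : -Real.pi < θ ∧ θ < Real.pi <;>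
        simp [hs, hθ, abs_of_pos hs]
    · simp [hs]
  rw [← integral_indicator measurableSet_ball, ← Complex.integral_comp_polarCoord_symm,
    ← integral_indicator polarCoord.open_target.measurableSet, hind,
    integral_indicator (measurableSet_Ioo.prod measurableSet_Ioo), Measure.volume_eq_prod,
    setIntegral_prod]
  · rw [intervalIntegral.integral_of_le hr, integral_Ioc_eq_integral_Ioo]
    refine setIntegral_congr_fun measurableSet_Ioo fun s _ => ?_
    dsimp only
    rw [intervalIntegral.integral_of_le (by linarith [Real.pi_pos]), integral_Ioc_eq_integral_Ioo]
  · rw [← Measure.volume_eq_prod]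
    exact ((by fun_prop : Continuous fun p : ℝ × ℝ =>
      p.1 * F (circleMap 0 p.1 p.2)).continuousOn.integrableOn_compact
        (isCompact_Icc.prod isCompact_Icc)).mono_set (prod_mono Ioo_subset_Icc_self
          Ioo_subset_Icc_self)

lemma circleAverage_eq_integral_neg_pi_pi (φ : ℂ → ℝ) (R : ℝ) :
    Real.circleAverage φ 0 R =
      (2 * Real.pi)⁻¹ * ∫ θ in (-Real.pi)..Real.pi, φ (circleMap 0 R θ) := by
  have hper : Function.Periodic (fun θ => φ (circleMap 0 R θ)) (2 * Real.pi) := fun θ => by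
    simp [periodic_circleMap 0 R θ]
  have := hper.intervalIntegral_add_eq 0 (-Real.pi)
  rw [zero_add, show -Real.pi + 2 * Real.pi = Real.pi by ring] at this
  rw [Real.circleAverage_def, this, smul_eq_mul]

/-- The Riesz-type representation of the circular means of a `C²` function. -/
theorem integral_integral_lap_div {φ : ℂ → ℝ} (hφ : ContDiff ℝ 2 φ) {R : ℝ} (hR : 0 ≤ R) :
    ∫ s in (0 : ℝ)..R, (∫ z in ball (0 : ℂ) s, lap φ z) / s =
      2 * Real.pi * (Real.circleAverage φ 0 R - φ 0) := by
  have hc := hφ.continuous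
  have hc' := hφ.continuous_fderiv (by norm_num)
  calc ∫ s in (0 : ℝ)..R, (∫ z in ball (0 : ℂ) s, lap φ z) / s
      = ∫ s in (0 : ℝ)..R, ∫ θ in (-Real.pi)..Real.pi,
          fderiv ℝ φ (circleMap 0 s θ) (circleMap 0 1 θ) := by
        rw [intervalIntegral.integral_of_le hR, intervalIntegral.integral_of_le hR]
        refine setIntegral_congr_fun measurableSet_Ioc fun s hs => ?_
        rw [integral_ball_eq_polar (continuous_lap hφ) hs.1.le, ← mul_integral_radial hφ,
          mul_div_cancel_left₀ _ hs.1.ne']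
    _ = ∫ θ in (-Real.pi)..Real.pi, (φ (circleMap 0 R θ) - φ 0) := by
        rw [intervalIntegral_swap_of_continuous (by unfold Function.uncurry; fun_prop)]
        refine intervalIntegral.integral_congr fun θ _ => ?_
        rw [intervalIntegral.integral_eq_sub_of_hasDerivAt
          (fun s _ => hasDerivAt_radial hφ s θ)
          (Continuous.intervalIntegrable (by fun_prop) _ _)]
        simp
    _ = 2 * Real.pi * (Real.circleAverage φ 0 R - φ 0) := by
        rw [intervalIntegral.integral_sub (Continuous.intervalIntegrable (by fun_prop) _ _)
          (by simp), circleAverage_eq_integral_neg_pi_pi, intervalIntegral.integral_const,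
          smul_eq_mul]
        field_simp
        ring

end Green

/-- **Jensen-type inequality.**  If `f` is entire with `f(0) = 1` and
`log|f| ≤ φ + K` for a `C²` function `φ`, then for every `R > 0`,
`∫₀^R n(0,s)/s ds ≤ φ(0) + K + (1/2π) ∫₀^R s⁻¹ (∫_{D(0,s)} Δφ dA) ds`. -/
theorem jensen_inequality_with_weight
    (φ : ℂ → ℝ) (hφ : ContDiff ℝ 2 φ) (K : ℝ) (hK : 0 ≤ K)
    (f : ℂ → ℂ) (hf : Differentiable ℂ f) (hf0 : f 0 = 1)
    (hbd : ∀ z : ℂ, Real.log ‖f z‖ ≤ φ z + K) :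
    ∀ R > (0 : ℝ),
      (∫ s in (0 : ℝ)..R, (nZeros f s : ℝ) / s) ≤
        φ 0 + K + (1 / (2 * Real.pi)) *
          ∫ s in (0 : ℝ)..R, (∫ z in Metric.ball (0 : ℂ) s, lap φ z) / s := by
  intro R hR
  have han : AnalyticOnNhd ℂ f (sphere 0 |R|) := fun z _ => hf.analyticAt z
  have hci : CircleIntegrable (fun z => φ z) 0 R := hφ.continuous.continuousOn.circleIntegrable'
  have hmono : Real.circleAverage (Real.log ‖f ·‖) 0 R ≤
      Real.circleAverage (fun z => φ z + K) 0 R :=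
    Real.circleAverage_mono han.meromorphicOn.circleIntegrable_log_norm
      (hci.add (circleIntegrable_const K 0 R)) fun z _ => hbd z
  rw [Real.circleAverage_fun_add hci (circleIntegrable_const K 0 R),
    Real.circleAverage_const] at hmono
  rw [integral_nZeros_div hf hf0 hR, integral_integral_lap_div hφ hR.le]
  calc Real.circleAverage (Real.log ‖f ·‖) 0 R ≤ Real.circleAverage φ 0 R + K := hmono
    _ = _ := by
      field_simp
      ring
end
end
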